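/- arXiv:1907.12922 — 6 statements merged into one kernel-verified Lean document; each statement's English description precedes it below -/
import Mathlib

section
/- For every t ∈ [0,T] and every integrable random variable Y, almost surely P(τ > t | ℱ_t) · E[1_{τ>t} Y | 𝒢_t] = P(τ > t | 𝒢_t) · E[1_{τ>t} Y | ℱ_t]. -/
open MeasureTheory

/-- Two σ-algebras `m ≤ m'` with the same trace on a set `A ∈ m'` have conditional expectations
related on `A` by the Bayes-type formula `μ(A | m) · μ[1_A Y | m'] = μ(A | m') · μ[1_A Y | m]`. -/
theorem condExp_indicator_mul_condExp_of_trace_le {Ω : Type*} {m m' m0 : MeasurableSpace Ω}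
    {μ : Measure Ω} [IsFiniteMeasure μ] {A : Set Ω} {Y : Ω → ℝ}
    (hm : m ≤ m') (hm' : m' ≤ m0) (hA : MeasurableSet[m'] A)
    (htrace : ∀ B, MeasurableSet[m'] B → ∃ F, MeasurableSet[m] F ∧ B ∩ A = F ∩ A)
    (hY : Integrable Y μ) :
    μ[A.indicator fun _ => (1 : ℝ) | m] * μ[A.indicator Y | m'] =ᵐ[μ]
      μ[A.indicator fun _ => (1 : ℝ) | m'] * μ[A.indicator Y | m] := by
  have hA0 : MeasurableSet A := hm' _ hA
  have hmm0 : m ≤ m0 := hm.trans hm'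
  set p := μ[A.indicator fun _ => (1 : ℝ) | m]
  set q := μ[A.indicator Y | m]
  have h_one : Integrable (A.indicator fun _ => (1 : ℝ)) μ := (integrable_const 1).indicator hA0
  have hAY : Integrable (A.indicator Y) μ := hY.indicator hA0
  have hp_meas : StronglyMeasurable[m] p := stronglyMeasurable_condExp
  have hq_meas : StronglyMeasurable[m] q := stronglyMeasurable_condExp
  have hp_bdd : ∀ᵐ ω ∂μ, ‖p ω‖ ≤ 1 :=
    ae_bdd_abs_condExp_of_ae_bdd_abs
      (ae_of_all _ fun ω => by by_cases h : ω ∈ A <;> simp [h])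
  have hpAY : Integrable (p * A.indicator Y) μ :=
    hAY.bdd_mul (hp_meas.mono hmm0).aestronglyMeasurable hp_bdd
  have hq_mul : q * A.indicator (fun _ => (1 : ℝ)) = A.indicator q := by
    ext ω; by_cases h : ω ∈ A <;> simp [h]
  have hAq : Integrable (A.indicator q) μ := integrable_condExp.indicator hA0
  have h_left : μ[p * A.indicator Y | m] =ᵐ[μ] p * q :=
    condExp_mul_of_stronglyMeasurable_left hp_meas hpAY hAY
  have h_right : μ[A.indicator q | m] =ᵐ[μ] q * p := by
    rw [← hq_mul] at hAq ⊢
    exact condExp_mul_of_stronglyMeasurable_left hq_meas hAq h_one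
  have h_condExp : A.indicator q =ᵐ[μ] μ[p * A.indicator Y | m'] := by
    refine ae_eq_condExp_of_forall_setIntegral_eq hm' hpAY (fun _ _ _ => hAq.integrableOn) ?_
      ((hq_meas.mono hm).indicator hA).aestronglyMeasurable
    intro B hB _
    obtain ⟨F, hF, hBF⟩ := htrace B hB
    have h_trace (f : Ω → ℝ) : ∫ ω in B, A.indicator f ω ∂μ = ∫ ω in F, A.indicator f ω ∂μ := by
      rw [setIntegral_indicator hA0, setIntegral_indicator hA0, hBF]
    have h_mul : p * A.indicator Y = A.indicator (p * Y) := by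
      ext ω; by_cases h : ω ∈ A <;> simp [h]
    calc ∫ ω in B, A.indicator q ω ∂μ
        = ∫ ω in F, (μ[A.indicator q | m]) ω ∂μ := by
          rw [h_trace, setIntegral_condExp hmm0 hAq hF]
      _ = ∫ ω in F, (μ[p * A.indicator Y | m]) ω ∂μ := by
          refine integral_congr_ae (ae_restrict_of_ae ?_)
          rw [mul_comm q p] at h_right
          exact h_right.trans h_left.symm
      _ = ∫ ω in B, (p * A.indicator Y) ω ∂μ := by
          rw [setIntegral_condExp hmm0 hpAY hF, h_mul, h_trace]
  have h_pull : μ[p * A.indicator Y | m'] =ᵐ[μ] p * μ[A.indicator Y | m'] :=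
    condExp_mul_of_stronglyMeasurable_left (hp_meas.mono hm) hpAY hAY
  have h_self : μ[A.indicator fun _ => (1 : ℝ) | m'] = A.indicator fun _ => (1 : ℝ) :=
    condExp_of_stronglyMeasurable hm' (stronglyMeasurable_const.indicator hA) h_one
  rw [h_self, mul_comm _ q, hq_mul]
  exact (h_condExp.trans h_pull).symm

/-- On `{τ > t}`, every event of the σ-algebra `m ∨ σ({τ ≤ s} : s ≤ t)` coincides with an event
of `m`. -/
theorem exists_measurableSet_inter_eq_of_sup_generateFrom {Ω : Type*} (m : MeasurableSpace Ω)
    (τ : Ω → ℝ) (t : ℝ) {B : Set Ω}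
    (hB : MeasurableSet[m ⊔ MeasurableSpace.generateFrom {A | ∃ s ≤ t, A = {ω | τ ω ≤ s}}] B) :
    ∃ F, MeasurableSet[m] F ∧ B ∩ τ ⁻¹' Set.Ioi t = F ∩ τ ⁻¹' Set.Ioi t := by
  have h_le : m ⊔ MeasurableSpace.generateFrom {A | ∃ s ≤ t, A = {ω | τ ω ≤ s}} ≤
      (m.comap ((↑) : τ ⁻¹' Set.Ioi t → Ω)).map (↑) := by
    refine sup_le MeasurableSpace.le_map_comap (MeasurableSpace.generateFrom_le ?_)
    rintro _ ⟨s, hs, rfl⟩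
    refine ⟨∅, MeasurableSet.empty, ?_⟩
    ext ⟨ω, hω⟩
    simpa using hs.trans_lt hω
  obtain ⟨F, hF, hFB⟩ := h_le B hB
  refine ⟨F, hF, ?_⟩
  rw [Set.inter_comm B, Set.inter_comm F]
  exact (Subtype.preimage_val_eq_preimage_val_iff _ _ _).mp hFB.symm

/-- **Key Lemma** (Bielecki–Jeanblanc–Rutkowski): for any integrable random variable `Y`
and any `t ∈ [0,T]`, almost surely
`P(τ > t | ℱ_t) · E[1_{τ>t} Y | 𝒢_t] = P(τ > t | 𝒢_t) · E[1_{τ>t} Y | ℱ_t]`,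
where `𝒢_t = ℱ_t ∨ σ(1_{τ ≤ s} : s ≤ t)` is the progressively enlarged filtration. -/
theorem stmt0
    {Ω : Type*} {mΩ : MeasurableSpace Ω} (P : Measure Ω) [IsProbabilityMeasure P]
    (T : ℝ) (hT : 0 ≤ T)
    (ℱ : Filtration ℝ mΩ)
    (τ : Ω → ℝ) (hτmeas : Measurable τ) (hτpos : ∀ ω, 0 < τ ω)
    (𝒢 : ℝ → MeasurableSpace Ω)
    (h𝒢 : ∀ t, 𝒢 t = (ℱ t : MeasurableSpace Ω) ⊔
      MeasurableSpace.generateFrom {A | ∃ s ≤ t, A = {ω | τ ω ≤ s}})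
    (h𝒢le : ∀ t, 𝒢 t ≤ mΩ)
    (t : ℝ) (ht : t ∈ Set.Icc 0 T)
    (Y : Ω → ℝ) (hY : Integrable Y P) :
    ∀ᵐ ω ∂P,
      (P[Set.indicator (τ ⁻¹' Set.Ioi t) (fun _ => (1 : ℝ)) | ℱ t]) ω *
        (P[Set.indicator (τ ⁻¹' Set.Ioi t) Y | 𝒢 t]) ω
      = (P[Set.indicator (τ ⁻¹' Set.Ioi t) (fun _ => (1 : ℝ)) | 𝒢 t]) ω *
        (P[Set.indicator (τ ⁻¹' Set.Ioi t) Y | ℱ t]) ω := by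
  refine condExp_indicator_mul_condExp_of_trace_le (h𝒢 t ▸ le_sup_left) (h𝒢le t) ?_ ?_ hY
  · have h_compl : τ ⁻¹' Set.Ioi t = {ω | τ ω ≤ t}ᶜ := by ext; simp
    rw [h_compl, h𝒢 t]
    have h_gen := MeasurableSpace.measurableSet_generateFrom
      (s := {A | ∃ s ≤ t, A = {ω | τ ω ≤ s}}) ⟨t, le_rfl, rfl⟩
    exact ((le_sup_right : _ ≤ (ℱ t : MeasurableSpace Ω) ⊔ _) _ h_gen).compl
  · intro B hB
    rw [h𝒢 t] at hB
    exact exists_measurableSet_inter_eq_of_sup_generateFrom (ℱ t) τ t hB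
end

section
/- Fix 0 ≤ t ≤ T. For every bounded ℱ_T-measurable random variable ξ, almost surely E[ξ 1_{τ>T} | 𝒢_t] = 1_{τ>t} · E[ξ e^{-(Γ_T - Γ_t)} | ℱ_t]. -/
open MeasureTheory

/-- Pull-out property of the conditional expectation for nonnegative, possibly non-integrable,
factors. -/
theorem lintegral_mul_ofReal_condExp {Ω : Type*} {m m0 : MeasurableSpace Ω} (hm : m ≤ m0)
    (μ : Measure Ω) [IsFiniteMeasure μ] {g : Ω → ℝ} (hg : Integrable g μ) (hg0 : 0 ≤ᵐ[μ] g)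
    {f : Ω → ENNReal} (hf : Measurable[m] f) :
    ∫⁻ ω, ENNReal.ofReal ((μ[g | m]) ω) * f ω ∂μ = ∫⁻ ω, ENNReal.ofReal (g ω) * f ω ∂μ := by
  have hc0 : 0 ≤ᵐ[μ] μ[g | m] := condExp_nonneg hg0
  have hf' : Measurable f := hf.mono hm le_rfl
  have htrim : (μ.withDensity fun ω => ENNReal.ofReal ((μ[g | m]) ω)).trim hm
      = (μ.withDensity fun ω => ENNReal.ofReal (g ω)).trim hm := by
    refine @Measure.ext _ m _ _ fun s hs => ?_
    rw [trim_measurableSet_eq hm hs, trim_measurableSet_eq hm hs,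
      withDensity_apply _ (hm s hs), withDensity_apply _ (hm s hs),
      ← ofReal_integral_eq_lintegral_ofReal integrable_condExp.integrableOn
        (ae_restrict_of_ae hc0),
      ← ofReal_integral_eq_lintegral_ofReal hg.integrableOn (ae_restrict_of_ae hg0),
      setIntegral_condExp hm hg hs]
  have h := congrArg (fun ν => @lintegral _ m ν f) htrim
  simp only [lintegral_trim hm hf] at h
  rwa [lintegral_withDensity_eq_lintegral_mul₀
      integrable_condExp.aestronglyMeasurable.aemeasurable.ennreal_ofReal hf'.aemeasurable,
    lintegral_withDensity_eq_lintegral_mul₀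
      hg.aestronglyMeasurable.aemeasurable.ennreal_ofReal hf'.aemeasurable] at h

/-- Before the random time `τ`, the information in the progressively enlarged `σ`-algebra
coincides with the information in the reference `σ`-algebra. -/
theorem exists_measurableSet_inter_eq_of_enlargement {Ω : Type*} {m : MeasurableSpace Ω}
    (τ : Ω → ℝ) (t : ℝ) {A : Set Ω}
    (hA : MeasurableSet[m ⊔ MeasurableSpace.generateFrom {A | ∃ s ≤ t, A = {ω | τ ω ≤ s}}] A) :
    ∃ B, MeasurableSet[m] B ∧ A ∩ τ ⁻¹' Set.Ioi t = B ∩ τ ⁻¹' Set.Ioi t := by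
  let m' : MeasurableSpace Ω :=
    { MeasurableSet' := fun A => ∃ B, MeasurableSet[m] B ∧
        A ∩ τ ⁻¹' Set.Ioi t = B ∩ τ ⁻¹' Set.Ioi t
      measurableSet_empty := ⟨∅, MeasurableSet.empty, rfl⟩
      measurableSet_compl := by
        rintro A ⟨B, hB, h⟩
        refine ⟨Bᶜ, hB.compl, ?_⟩
        ext ω
        have := Set.ext_iff.1 h ω
        simp only [Set.mem_inter_iff, Set.mem_compl_iff] at this ⊢
        tauto
      measurableSet_iUnion := by
        intro A hA
        choose B hB h using hA
        exact ⟨⋃ i, B i, MeasurableSet.iUnion hB, by simp only [Set.iUnion_inter, h]⟩ }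
  have hle : m ⊔ MeasurableSpace.generateFrom {A | ∃ s ≤ t, A = {ω | τ ω ≤ s}} ≤ m' := by
    refine sup_le (fun B hB => ⟨B, hB, rfl⟩) (MeasurableSpace.generateFrom_le ?_)
    rintro _ ⟨s, hs, rfl⟩
    refine ⟨∅, @MeasurableSet.empty _ m, ?_⟩
    ext ω
    simp only [Set.mem_inter_iff, Set.mem_ofPred_eq, Set.mem_preimage, Set.mem_Ioi,
      Set.mem_empty_iff_false, false_and, iff_false, not_and, not_lt]
    exact fun h => h.trans hs
  exact hle A hA

/-- For a bounded `ℱ_T`-measurable payoff `ξ`, almost surely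
`E[ξ 1_{τ>T} | 𝒢_t] = 1_{τ>t} · E[ξ e^{-(Γ_T - Γ_t)} | ℱ_t]`,
where `F_s = P(τ ≤ s | ℱ_s) < 1` a.s., `Γ_s = -ln(1 - F_s)` is the hazard process
and `𝒢_t = ℱ_t ∨ σ(1_{τ ≤ s} : s ≤ t)` is the progressively enlarged filtration. -/
theorem stmt1
    {Ω : Type*} {mΩ : MeasurableSpace Ω} (P : Measure Ω) [IsProbabilityMeasure P]
    (T : ℝ) (hT : 0 ≤ T)
    (ℱ : Filtration ℝ mΩ)
    (τ : Ω → ℝ) (hτmeas : Measurable τ) (hτpos : ∀ ω, 0 < τ ω)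
    (𝒢 : ℝ → MeasurableSpace Ω)
    (h𝒢 : ∀ t, 𝒢 t = (ℱ t : MeasurableSpace Ω) ⊔
      MeasurableSpace.generateFrom {A | ∃ s ≤ t, A = {ω | τ ω ≤ s}})
    (h𝒢le : ∀ t, 𝒢 t ≤ mΩ)
    (F : ℝ → Ω → ℝ)
    (hF : ∀ s, F s =ᵐ[P] P[Set.indicator (τ ⁻¹' Set.Iic s) (fun _ => (1 : ℝ)) | ℱ s])
    (hFlt : ∀ s, ∀ᵐ ω ∂P, F s ω < 1)
    (Γ : ℝ → Ω → ℝ) (hΓ : ∀ s ω, Γ s ω = -Real.log (1 - F s ω))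
    (t : ℝ) (ht : 0 ≤ t) (htT : t ≤ T)
    (ξ : Ω → ℝ) (hξmeas : StronglyMeasurable[ℱ T] ξ)
    (hξbdd : ∃ C, ∀ ω, |ξ ω| ≤ C) :
    P[fun ω => ξ ω * Set.indicator (τ ⁻¹' Set.Ioi T) (fun _ => (1 : ℝ)) ω | 𝒢 t]
      =ᵐ[P] fun ω => Set.indicator (τ ⁻¹' Set.Ioi t) (fun _ => (1 : ℝ)) ω *
        (P[fun ω' => ξ ω' * Real.exp (-(Γ T ω' - Γ t ω')) | ℱ t]) ω := by
  obtain ⟨C, hC⟩ := hξbdd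
  let I : ℝ → Ω → ℝ := fun s => Set.indicator (τ ⁻¹' Set.Ioi s) (fun _ => (1 : ℝ))
  let G : ℝ → Ω → ℝ := fun s => P[I s | ℱ s]
  let h : Ω → ℝ := fun ω => ξ ω * Real.exp (-(Γ T ω - Γ t ω))
  have hI_meas (s : ℝ) : MeasurableSet (τ ⁻¹' Set.Ioi s) := hτmeas measurableSet_Ioi
  have hI_int (s : ℝ) : Integrable (I s) P := (integrable_const 1).indicator (hI_meas s)
  have hI_nonneg (s : ℝ) (ω : Ω) : 0 ≤ I s ω := Set.indicator_nonneg (fun _ _ => zero_le_one) ω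
  have hI_le (s : ℝ) (ω : Ω) : I s ω ≤ 1 := Set.indicator_le_self' (fun _ _ => zero_le_one) ω
  have hI_anti (ω : Ω) : I T ω ≤ I t ω :=
    Set.indicator_le_indicator_of_subset (Set.preimage_mono (Set.Ioi_subset_Ioi htT))
      (fun _ => zero_le_one) ω
  have hG (s : ℝ) : ∀ᵐ ω ∂P, G s ω = 1 - F s ω := by
    have hIeq : I s = (fun _ => (1 : ℝ)) - Set.indicator (τ ⁻¹' Set.Iic s) (fun _ => (1 : ℝ)) := by
      ext ω
      by_cases hω : τ ω ≤ s <;> simp [I, Set.indicator, hω]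
    have hsub := condExp_sub (m := ℱ s) (integrable_const (1 : ℝ) (μ := P))
      ((integrable_const (1 : ℝ)).indicator (hτmeas (measurableSet_Iic (a := s))))
    rw [← hIeq, condExp_const (ℱ.le s)] at hsub
    filter_upwards [hsub, hF s] with ω h1 h2
    rw [h2]
    exact h1
  have hG_pos (s : ℝ) : ∀ᵐ ω ∂P, 0 < G s ω := by
    filter_upwards [hG s, hFlt s] with ω h1 h2
    linarith
  have hG_sm (s : ℝ) : StronglyMeasurable[ℱ s] (G s) := stronglyMeasurable_condExp
  have hG_int (s : ℝ) : Integrable (G s) P := integrable_condExp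
  have h_eq : h =ᵐ[P] fun ω => ξ ω * (G T ω * (G t ω)⁻¹) := by
    filter_upwards [hG t, hG T, hG_pos t, hG_pos T] with ω h1 h2 h3 h4
    simp only [h, hΓ, ← h1, ← h2]
    rw [show -(-Real.log (G T ω) - -Real.log (G t ω)) = Real.log (G T ω) - Real.log (G t ω) by ring,
      Real.exp_sub, Real.exp_log h3, Real.exp_log h4, div_eq_mul_inv]
  have hratio_int : Integrable (fun ω => G T ω * (G t ω)⁻¹) P := by
    have hmeas : AEStronglyMeasurable (fun ω => G T ω * (G t ω)⁻¹) P :=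
      ((hG_int T).aestronglyMeasurable.aemeasurable.mul
        (hG_int t).aestronglyMeasurable.aemeasurable.inv).aestronglyMeasurable
    have hf : Measurable[ℱ t] fun ω => ENNReal.ofReal ((G t ω)⁻¹) :=
      (hG_sm t).measurable.inv.ennreal_ofReal
    refine ⟨hmeas, ?_⟩
    rw [hasFiniteIntegral_iff_ofReal (by
      filter_upwards [hG_pos t, hG_pos T] with ω h1 h2
      exact mul_nonneg h2.le (inv_nonneg.2 h1.le))]
    calc ∫⁻ ω, ENNReal.ofReal (G T ω * (G t ω)⁻¹) ∂P
        = ∫⁻ ω, ENNReal.ofReal (G T ω) * ENNReal.ofReal ((G t ω)⁻¹) ∂P := by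
          refine lintegral_congr_ae ?_
          filter_upwards [hG_pos T] with ω h1
          exact ENNReal.ofReal_mul h1.le
      _ = ∫⁻ ω, ENNReal.ofReal (I T ω) * ENNReal.ofReal ((G t ω)⁻¹) ∂P :=
          lintegral_mul_ofReal_condExp (ℱ.le T) P (hI_int T) (ae_of_all _ (hI_nonneg T))
            (hf.mono (ℱ.mono htT) le_rfl)
      _ ≤ ∫⁻ ω, ENNReal.ofReal (I t ω) * ENNReal.ofReal ((G t ω)⁻¹) ∂P :=
          lintegral_mono fun ω => by
            dsimp only
            gcongr
            exact hI_anti ω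
      _ = ∫⁻ ω, ENNReal.ofReal (G t ω) * ENNReal.ofReal ((G t ω)⁻¹) ∂P :=
          (lintegral_mul_ofReal_condExp (ℱ.le t) P (hI_int t) (ae_of_all _ (hI_nonneg t)) hf).symm
      _ = ∫⁻ _, 1 ∂P := by
          refine lintegral_congr_ae ?_
          filter_upwards [hG_pos t] with ω h1
          rw [← ENNReal.ofReal_mul h1.le, mul_inv_cancel₀ h1.ne', ENNReal.ofReal_one]
      _ < ⊤ := by simp
  have hξ_sm : AEStronglyMeasurable ξ P := (hξmeas.mono (ℱ.le T)).aestronglyMeasurable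
  have hξ_bdd : ∀ᵐ ω ∂P, ‖ξ ω‖ ≤ C := ae_of_all _ hC
  have hh_int : Integrable h P := (hratio_int.bdd_mul hξ_sm hξ_bdd).congr h_eq.symm
  have hξI_int : Integrable (fun ω => ξ ω * I T ω) P := (hI_int T).bdd_mul hξ_sm hξ_bdd
  have hξG_int : Integrable (fun ω => ξ ω * G T ω) P := (hG_int T).bdd_mul hξ_sm hξ_bdd
  have hIY_int : Integrable (fun ω => I t ω * (P[h | ℱ t]) ω) P := by
    refine integrable_condExp.bdd_mul (c := 1) (hI_int t).aestronglyMeasurable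
      (ae_of_all _ fun ω => ?_)
    rw [Real.norm_of_nonneg (hI_nonneg t ω)]
    exact hI_le t ω
  have hGh : (fun ω => G t ω * h ω) =ᵐ[P] fun ω => ξ ω * G T ω := by
    filter_upwards [h_eq, hG_pos t] with ω h1 h2
    rw [h1]
    field_simp
  have hcond : P[fun ω => I t ω * (P[h | ℱ t]) ω | ℱ t] =ᵐ[P] P[fun ω => ξ ω * I T ω | ℱ t] := by
    calc P[fun ω => I t ω * (P[h | ℱ t]) ω | ℱ t]
        =ᵐ[P] fun ω => G t ω * (P[h | ℱ t]) ω :=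
          condExp_mul_of_stronglyMeasurable_right stronglyMeasurable_condExp hIY_int (hI_int t)
      _ =ᵐ[P] P[fun ω => G t ω * h ω | ℱ t] :=
          (condExp_mul_of_stronglyMeasurable_left (hG_sm t) (hξG_int.congr hGh.symm) hh_int).symm
      _ =ᵐ[P] P[fun ω => ξ ω * G T ω | ℱ t] := condExp_congr_ae hGh
      _ =ᵐ[P] P[P[fun ω => ξ ω * I T ω | ℱ T] | ℱ t] :=
          condExp_congr_ae
            (condExp_mul_of_stronglyMeasurable_left hξmeas hξI_int (hI_int T)).symm
      _ =ᵐ[P] P[fun ω => ξ ω * I T ω | ℱ t] :=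
          condExp_condExp_of_le (ℱ.mono htT) (ℱ.le T)
  have hle : (ℱ t : MeasurableSpace Ω) ≤ 𝒢 t := by
    rw [h𝒢]
    exact le_sup_left
  have hτ𝒢 : MeasurableSet[𝒢 t] (τ ⁻¹' Set.Ioi t) := by
    have hIic : MeasurableSet[𝒢 t] {ω | τ ω ≤ t} := by
      rw [h𝒢]
      exact le_sup_right (a := (ℱ t : MeasurableSpace Ω)) _
        (MeasurableSpace.measurableSet_generateFrom ⟨t, le_rfl, rfl⟩)
    convert hIic.compl using 1
    ext ω
    simp
  have hset (f : Ω → ℝ) (hf : ∀ ω, τ ω ≤ t → f ω = 0) {A B : Set Ω} (hA : MeasurableSet A)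
      (hB : MeasurableSet B) (hAB : A ∩ τ ⁻¹' Set.Ioi t = B ∩ τ ⁻¹' Set.Ioi t) :
      ∫ ω in A, f ω ∂P = ∫ ω in B, f ω ∂P := by
    rw [← integral_indicator hA, ← integral_indicator hB]
    congr 1
    ext ω
    by_cases hω : τ ω ≤ t
    · simp [Set.indicator, hf ω hω]
    · have := Set.ext_iff.1 hAB ω
      simp only [Set.mem_inter_iff, Set.mem_preimage, Set.mem_Ioi, not_le.1 hω, and_true] at this
      by_cases hωB : ω ∈ B <;> simp [this, hωB]
  refine (ae_eq_condExp_of_forall_setIntegral_eq (h𝒢le t) hξI_int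
    (fun _ _ _ => hIY_int.integrableOn) (fun A hA _ => ?_) ?_).symm
  · have hA' := hA
    rw [h𝒢] at hA'
    obtain ⟨B, hB, hAB⟩ := exists_measurableSet_inter_eq_of_enlargement τ t hA'
    have hBm := ℱ.le t B hB
    have hAm := h𝒢le t A hA
    calc ∫ ω in A, I t ω * (P[h | ℱ t]) ω ∂P
        = ∫ ω in B, I t ω * (P[h | ℱ t]) ω ∂P :=
          hset _ (fun ω hω => by simp [I, hω]) hAm hBm hAB
      _ = ∫ ω in B, (P[fun ω => I t ω * (P[h | ℱ t]) ω | ℱ t]) ω ∂P :=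
          (setIntegral_condExp (ℱ.le t) hIY_int hB).symm
      _ = ∫ ω in B, (P[fun ω => ξ ω * I T ω | ℱ t]) ω ∂P :=
          integral_congr_ae (ae_restrict_of_ae hcond)
      _ = ∫ ω in B, ξ ω * I T ω ∂P := setIntegral_condExp (ℱ.le t) hξI_int hB
      _ = ∫ ω in A, ξ ω * I T ω ∂P :=
          (hset _ (fun ω hω => by simp [I, hω.trans htT]) hAm hBm hAB).symm
  · exact ((stronglyMeasurable_const.indicator hτ𝒢).mul
      (stronglyMeasurable_condExp.mono hle)).aestronglyMeasurable
end

section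
/- Assume the hazard process is absolutely continuous, Γ_s = ∫_0^s λ_u du for a nonnegative progressively measurable intensity process λ, and let M = (M_s)_{s∈[t,T]} be a bounded ℱ-martingale with càdlàg paths which almost surely does not jump at τ. Then almost surely E[M_τ 1_{t<τ≤T} | 𝒢_t] = 1_{τ>t} · E[ ∫_t^T M_s λ_s e^{-(Γ_s - Γ_t)} ds | ℱ_t ]. -/
open MeasureTheory

/-- If `G` is the primitive of a nonnegative integrable density `l`, then `l * exp (-G)` has
primitive `-exp (-G)`. -/
lemma integral_mul_exp_neg_primitive {l : ℝ → ℝ} {T a b : ℝ} (hl : ∀ s, 0 ≤ l s)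
    (hint : IntegrableOn l (Set.Icc 0 T)) (ha : 0 ≤ a) (hab : a ≤ b) (hb : b ≤ T) :
    IntervalIntegrable (fun s => l s * Real.exp (-∫ u in (0 : ℝ)..s, l u)) volume a b ∧
    ∫ s in a..b, l s * Real.exp (-∫ u in (0 : ℝ)..s, l u) =
      Real.exp (-∫ u in (0 : ℝ)..a, l u) - Real.exp (-∫ u in (0 : ℝ)..b, l u) := by
  set G : ℝ → ℝ := fun s => ∫ u in (0 : ℝ)..s, l u with hG
  have h0b : 0 ≤ b := ha.trans hab
  have hi0 : IntervalIntegrable l volume 0 b :=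
    (intervalIntegrable_iff_integrableOn_Icc_of_le h0b).2
      (hint.mono_set (Set.Icc_subset_Icc_right hb))
  have hsub : Set.uIcc a b ⊆ Set.uIcc 0 b := by
    rw [Set.uIcc_of_le hab, Set.uIcc_of_le h0b]
    exact Set.Icc_subset_Icc_left ha
  have hi : IntervalIntegrable l volume a b := hi0.mono_set hsub
  have hGac : AbsolutelyContinuousOnInterval G a b :=
    (hi0.absolutelyContinuousOnInterval_intervalIntegral (by simp)).mono hsub
  have hGnn : ∀ s ∈ Set.uIcc a b, 0 ≤ G s := fun s hs =>
    intervalIntegral.integral_nonneg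
      (by rw [Set.uIcc_of_le hab] at hs; exact ha.trans hs.1) (fun u _ => hl u)
  have hexp : ∀ x y : ℝ, 0 ≤ x → 0 ≤ y → dist (Real.exp (-x)) (Real.exp (-y)) ≤ dist x y := by
    intro x y hx hy
    wlog hxy : x ≤ y generalizing x y
    · rw [dist_comm, dist_comm x]
      exact this y x hy hx (le_of_not_ge hxy)
    have h1 : Real.exp (-y) ≤ Real.exp (-x) := Real.exp_le_exp.2 (by linarith)
    rw [Real.dist_eq, Real.dist_eq, abs_of_nonneg (by linarith), abs_of_nonpos (by linarith)]
    have h2 : Real.exp (-y) = Real.exp (-x) * Real.exp (-(y - x)) := by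
      rw [← Real.exp_add]; ring_nf
    have h3 := Real.add_one_le_exp (-(y - x))
    have h4 : Real.exp (-x) ≤ 1 := Real.exp_le_one_iff.2 (by linarith)
    nlinarith [Real.exp_pos (-x)]
  have hEac : AbsolutelyContinuousOnInterval (fun s => -Real.exp (-G s)) a b := by
    refine AbsolutelyContinuousOnInterval.fun_neg ?_
    rw [absolutelyContinuousOnInterval_iff] at hGac ⊢
    intro ε hε
    obtain ⟨δ, hδ, h⟩ := hGac ε hε
    refine ⟨δ, hδ, fun E hE hlt => lt_of_le_of_lt (Finset.sum_le_sum fun i hi => ?_) (h E hE hlt)⟩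
    exact hexp _ _ (hGnn _ (hE.1 i hi).1) (hGnn _ (hE.1 i hi).2)
  refine ⟨hi.mul_continuousOn (Real.continuous_exp.comp_continuousOn hGac.continuousOn.neg), ?_⟩
  have hmain := hEac.integral_deriv_eq_sub
  rw [neg_sub_neg] at hmain
  rw [← hmain]
  refine intervalIntegral.integral_congr_ae ?_
  filter_upwards [hi0.ae_hasDerivAt_integral] with x hx hxm
  have hd : HasDerivAt G (l x) x := hx (hsub (Set.uIoc_subset_uIcc hxm)) 0 (by simp)
  have hd' : HasDerivAt (fun s => -Real.exp (-G s)) (-(Real.exp (-G x) * -l x)) x :=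
    hd.neg.exp.neg
  rw [hd'.deriv]
  ring

/-- A function with left limits on `(a, b]` is left continuous almost everywhere there. -/
lemma ae_tendsto_left_of_forall_exists_left_limit {f : ℝ → ℝ} {a b : ℝ}
    (h : ∀ u ∈ Set.Ioc a b, ∃ l, Filter.Tendsto f (nhdsWithin u (Set.Iio u)) (nhds l)) :
    ∀ᵐ u, u ∈ Set.Ioc a b → Filter.Tendsto f (nhdsWithin u (Set.Iio u)) (nhds (f u)) := by
  set N : Set ℝ := ⋃ q : ℚ,
    ({x ∈ Set.Ioi (q : ℝ) | ∃ z, z < f x ∧ ∀ y ∈ Set.Ioi (q : ℝ), y < x → f y ≤ z} ∪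
    {x ∈ Set.Ioi (q : ℝ) | ∃ z, f x < z ∧ ∀ y ∈ Set.Ioi (q : ℝ), y < x → z ≤ f y}) with hN
  have hNc : N.Countable := Set.countable_iUnion fun q =>
    (countable_image_lt_image_Iio_within _ f).union (countable_image_gt_image_Iio_within _ f)
  filter_upwards [hNc.ae_notMem volume] with u hu hmem
  obtain ⟨l, hl⟩ := h u hmem
  have key : ∀ p : ℝ → Prop, (∀ᶠ y in nhds l, p y) →
      ∃ q : ℚ, (q : ℝ) < u ∧ ∀ y ∈ Set.Ioi (q : ℝ), y < u → p (f y) := by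
    intro p hp
    obtain ⟨c, hc, hcs⟩ := (mem_nhdsLT_iff_exists_Ioo_subset).1 (hl hp)
    obtain ⟨q, hq1, hq2⟩ := exists_rat_btwn (Set.mem_Iio.1 hc)
    exact ⟨q, hq2, fun y hy hyu => hcs ⟨hq1.trans hy, hyu⟩⟩
  rcases lt_trichotomy l (f u) with hlt | heq | hgt
  · obtain ⟨z, hz1, hz2⟩ := exists_between hlt
    obtain ⟨q, hq, hqy⟩ := key (· ≤ z) (eventually_le_nhds hz1)
    exact absurd (Set.mem_iUnion.2 ⟨q, Or.inl ⟨hq, z, hz2, hqy⟩⟩) hu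
  · rwa [← heq]
  · obtain ⟨z, hz1, hz2⟩ := exists_between hgt
    obtain ⟨q, hq, hqy⟩ := key (z ≤ ·) (eventually_ge_nhds hz2)
    exact absurd (Set.mem_iUnion.2 ⟨q, Or.inr ⟨hq, z, hz1, hqy⟩⟩) hu

/-- The `i`-th point of the uniform partition of `[a, b]` into `n + 1` pieces. -/
noncomputable def gridPoint (a b : ℝ) (n i : ℕ) : ℝ := a + (b - a) * (i / (n + 1))

lemma gridPoint_zero (a b : ℝ) (n : ℕ) : gridPoint a b n 0 = a := by simp [gridPoint]

lemma gridPoint_last (a b : ℝ) (n : ℕ) : gridPoint a b n (n + 1) = b := by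
  have : ((n : ℝ) + 1) ≠ 0 := by positivity
  simp [gridPoint, this]

lemma monotone_gridPoint {a b : ℝ} (hab : a ≤ b) (n : ℕ) : Monotone (gridPoint a b n) := by
  intro i j hij
  have : 0 ≤ b - a := sub_nonneg.2 hab
  unfold gridPoint
  gcongr

lemma gridPoint_mem_Icc {a b : ℝ} (hab : a ≤ b) {n i : ℕ} (hi : i ≤ n + 1) :
    gridPoint a b n i ∈ Set.Icc a b := by
  constructor
  · simpa [gridPoint_zero] using monotone_gridPoint hab n (Nat.zero_le i)
  · simpa [gridPoint_last] using monotone_gridPoint hab n hi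

lemma gridPoint_succ (a b : ℝ) (n i : ℕ) :
    gridPoint a b n (i + 1) = gridPoint a b n i + (b - a) / (n + 1) := by
  simp only [gridPoint]; push_cast; ring

/-- The step function taking on each piece `(pᵢ, pᵢ₊₁]` of the uniform partition of `[a, b]` into
`n + 1` pieces the value `f pᵢ`. -/
noncomputable def leftStep (f : ℝ → ℝ) (a b : ℝ) (n : ℕ) (s : ℝ) : ℝ :=
  ∑ i ∈ Finset.range (n + 1),
    Set.indicator (Set.Ioc (gridPoint a b n i) (gridPoint a b n (i + 1)))
      (fun _ => f (gridPoint a b n i)) s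

lemma leftStep_eq_zero {f : ℝ → ℝ} {a b : ℝ} (hab : a ≤ b) (n : ℕ) {s : ℝ}
    (hs : s ∉ Set.Ioc a b) : leftStep f a b n s = 0 := by
  refine Finset.sum_eq_zero fun i hi => Set.indicator_of_notMem (fun h => hs ?_) _
  have hi' := Finset.mem_range.1 hi
  exact ⟨(gridPoint_mem_Icc hab hi'.le).1.trans_lt h.1,
    h.2.trans (gridPoint_mem_Icc hab hi').2⟩

lemma exists_leftStep_eq {a b : ℝ} (hab : a ≤ b) (n : ℕ) {s : ℝ} (hs : s ∈ Set.Ioc a b) :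
    ∃ r ∈ Set.Icc a b, r < s ∧ s - (b - a) / (n + 1) ≤ r ∧
      ∀ f : ℝ → ℝ, leftStep f a b n s = f r := by
  have hex : ∃ j, s ≤ gridPoint a b n j := ⟨n + 1, by rw [gridPoint_last]; exact hs.2⟩
  classical
  obtain ⟨i, hi⟩ : ∃ i, Nat.find hex = i + 1 := Nat.exists_eq_succ_of_ne_zero fun h0 => by
    have := Nat.find_spec hex
    rw [h0, gridPoint_zero] at this
    exact absurd hs.1 (not_lt.2 this)
  have hi1 : s ≤ gridPoint a b n (i + 1) := hi ▸ Nat.find_spec hex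
  have hi2 : gridPoint a b n i < s := not_le.1 (Nat.find_min hex (by omega))
  have hin : i < n + 1 := by
    have : Nat.find hex ≤ n + 1 := Nat.find_min' hex (by rw [gridPoint_last]; exact hs.2)
    omega
  refine ⟨gridPoint a b n i, gridPoint_mem_Icc hab hin.le, hi2, ?_, fun f => ?_⟩
  · rw [gridPoint_succ] at hi1; linarith
  · unfold leftStep
    rw [Finset.sum_eq_single_of_mem i (Finset.mem_range.2 hin)]
    · exact Set.indicator_of_mem (s := Set.Ioc _ _) ⟨hi2, hi1⟩ (fun _ => f (gridPoint a b n i))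
    · intro j _ hj
      refine Set.indicator_of_notMem (fun h => ?_) _
      rcases lt_or_gt_of_ne hj with hlt | hgt
      · exact absurd (h.2.trans (monotone_gridPoint hab n hlt)) (not_le.2 hi2)
      · exact absurd (hi1.trans (monotone_gridPoint hab n hgt)) (not_le.2 h.1)

lemma abs_leftStep_le {f : ℝ → ℝ} {a b C : ℝ} (hab : a ≤ b)
    (hf : ∀ s ∈ Set.Icc a b, |f s| ≤ C) (n : ℕ) (s : ℝ) : |leftStep f a b n s| ≤ C := by
  by_cases hs : s ∈ Set.Ioc a b
  · obtain ⟨r, hr, -, -, h⟩ := exists_leftStep_eq hab n hs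
    rw [h]; exact hf r hr
  · rw [leftStep_eq_zero hab n hs, abs_zero]
    exact (abs_nonneg _).trans (hf a ⟨le_rfl, hab⟩)

lemma tendsto_leftStep {f : ℝ → ℝ} {a b s : ℝ} (hs : s ∈ Set.Ioc a b)
    (hf : Filter.Tendsto f (nhdsWithin s (Set.Iio s)) (nhds (f s))) :
    Filter.Tendsto (fun n => leftStep f a b n s) Filter.atTop (nhds (f s)) := by
  have hab : a ≤ b := hs.1.le.trans hs.2
  choose r hr1 hr2 hr3 hr4 using fun n => exists_leftStep_eq hab n hs
  have hr : Filter.Tendsto r Filter.atTop (nhdsWithin s (Set.Iio s)) := by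
    refine tendsto_nhdsWithin_iff.2 ⟨?_, Filter.Eventually.of_forall hr2⟩
    refine tendsto_of_tendsto_of_tendsto_of_le_of_le ?_ tendsto_const_nhds hr3
      (fun n => (hr2 n).le)
    have := (tendsto_one_div_add_atTop_nhds_zero_nat (𝕜 := ℝ)).const_mul (b - a)
    simpa [div_eq_mul_inv] using this.const_sub s
  simpa only [hr4, Function.comp_def] using hf.comp hr

lemma measurable_leftStep (f : ℝ → ℝ) (a b : ℝ) (n : ℕ) : Measurable (leftStep f a b n) :=
  Finset.measurable_sum _ fun _ _ => measurable_const.indicator measurableSet_Ioc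

/-- Left-point Riemann–Stieltjes sums of a bounded function `f` with left limits against
`-exp (-G)`, where `G` is the primitive of `l ≥ 0`, converge to `∫ f * l * exp (-G)`. -/
lemma tendsto_sum_mul_exp_neg_primitive {f l : ℝ → ℝ} {T a b C : ℝ} (hl : ∀ s, 0 ≤ l s)
    (hint : IntegrableOn l (Set.Icc 0 T)) (ha : 0 ≤ a) (hab : a ≤ b) (hb : b ≤ T)
    (hC : ∀ s ∈ Set.Icc a b, |f s| ≤ C)
    (hf : ∀ u ∈ Set.Ioc a b, ∃ l, Filter.Tendsto f (nhdsWithin u (Set.Iio u)) (nhds l)) :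
    Filter.Tendsto (fun n : ℕ => ∑ i ∈ Finset.range (n + 1), f (gridPoint a b n i) *
        (Real.exp (-∫ u in (0 : ℝ)..gridPoint a b n i, l u) -
          Real.exp (-∫ u in (0 : ℝ)..gridPoint a b n (i + 1), l u))) Filter.atTop
      (nhds (∫ s in a..b, f s * (l s * Real.exp (-∫ u in (0 : ℝ)..s, l u)))) ∧
    |∫ s in a..b, f s * (l s * Real.exp (-∫ u in (0 : ℝ)..s, l u))| ≤
      C * (Real.exp (-∫ u in (0 : ℝ)..a, l u) - Real.exp (-∫ u in (0 : ℝ)..b, l u)) := by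
  set h : ℝ → ℝ := fun s => l s * Real.exp (-∫ u in (0 : ℝ)..s, l u) with hh
  have hnn : ∀ s, 0 ≤ h s := fun s => mul_nonneg (hl s) (Real.exp_pos _).le
  obtain ⟨hhi, hhe⟩ := integral_mul_exp_neg_primitive hl hint ha hab hb
  have hCi : IntervalIntegrable (fun s => C * h s) volume a b := hhi.const_mul C
  constructor
  · have heq : ∀ n : ℕ, ∑ i ∈ Finset.range (n + 1), f (gridPoint a b n i) *
        (Real.exp (-∫ u in (0 : ℝ)..gridPoint a b n i, l u) -
          Real.exp (-∫ u in (0 : ℝ)..gridPoint a b n (i + 1), l u)) =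
        ∫ s in a..b, leftStep f a b n s * h s := by
      intro n
      rw [intervalIntegral.integral_of_le hab]
      have hexp : ∀ s, leftStep f a b n s * h s = ∑ i ∈ Finset.range (n + 1),
          Set.indicator (Set.Ioc (gridPoint a b n i) (gridPoint a b n (i + 1)))
            (fun s => f (gridPoint a b n i) * h s) s := by
        intro s
        rw [leftStep, Finset.sum_mul]
        refine Finset.sum_congr rfl fun i _ => ?_
        simp only [Set.indicator_apply]
        split_ifs <;> simp
      simp_rw [hexp]
      rw [integral_finsetSum _ fun i _ =>
        ((hhi.1.const_mul _).indicator measurableSet_Ioc)]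
      refine Finset.sum_congr rfl fun i hi => ?_
      have hi' := Finset.mem_range.1 hi
      have h1 := gridPoint_mem_Icc hab hi'.le
      have h2 : gridPoint a b n (i + 1) ∈ Set.Icc a b := gridPoint_mem_Icc hab hi'
      have h12 := monotone_gridPoint hab n (Nat.le_succ i)
      rw [setIntegral_indicator measurableSet_Ioc,
        Set.inter_eq_self_of_subset_right (Set.Ioc_subset_Ioc h1.1 h2.2),
        ← intervalIntegral.integral_of_le h12, intervalIntegral.integral_const_mul,
        (integral_mul_exp_neg_primitive hl hint (ha.trans h1.1) h12 (h2.2.trans hb)).2]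
    simp_rw [heq]
    refine intervalIntegral.tendsto_integral_filter_of_dominated_convergence
      (fun s => C * h s) ?_ ?_ hCi ?_
    · refine Filter.Eventually.of_forall fun n => ?_
      rw [Set.uIoc_of_le hab]
      exact (measurable_leftStep f a b n).aestronglyMeasurable.mul hhi.1.aestronglyMeasurable
    · refine Filter.Eventually.of_forall fun n => Filter.Eventually.of_forall fun s _ => ?_
      rw [Real.norm_eq_abs, abs_mul, abs_of_nonneg (hnn s)]
      exact mul_le_mul_of_nonneg_right (abs_leftStep_le hab hC n s) (hnn s)
    · filter_upwards [ae_tendsto_left_of_forall_exists_left_limit hf] with s hs hmem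
      rw [Set.uIoc_of_le hab] at hmem
      exact (tendsto_leftStep hmem (hs hmem)).mul_const _
  · rw [← hhe, ← intervalIntegral.integral_const_mul, ← Real.norm_eq_abs]
    refine intervalIntegral.norm_integral_le_of_norm_le hab
      (Filter.Eventually.of_forall fun s hs => ?_) hCi
    rw [Real.norm_eq_abs, abs_mul, abs_of_nonneg (hnn s)]
    exact mul_le_mul_of_nonneg_right (hC s (Set.Ioc_subset_Icc_self hs)) (hnn s)

/-- A bounded `m`-measurable factor does not distinguish a function from its conditional
expectation given `m` under the integral. -/
lemma integral_mul_eq_integral_mul_of_ae_eq_condExp {Ω : Type*} {m mΩ : MeasurableSpace Ω}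
    {P : Measure Ω} [IsFiniteMeasure P] (hm : m ≤ mΩ) {X f g : Ω → ℝ} {c : ℝ}
    (hX : AEStronglyMeasurable[m] X P) (hXc : ∀ᵐ ω ∂P, |X ω| ≤ c) (hf : Integrable f P)
    (hg : g =ᵐ[P] P[f | m]) : ∫ ω, X ω * f ω ∂P = ∫ ω, X ω * g ω ∂P := by
  have h := condExp_stronglyMeasurable_mul_of_bound₀ hm hX hf c hXc
  have h1 : ∫ ω, (X * f) ω ∂P = ∫ ω, (X * P[f | m]) ω ∂P := by
    rw [← integral_condExp hm, integral_congr_ae h]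
  simp only [Pi.mul_apply] at h1
  rw [h1]
  refine integral_congr_ae ?_
  filter_upwards [hg] with ω hω
  rw [hω]

/-- Progressive enlargement does not add information before the random time: on `{τ > t}` every
event of the enlarged σ-algebra coincides with an event of the original one. -/
lemma exists_measurableSet_inter_preimage_Ioi_eq {Ω : Type*} {m : MeasurableSpace Ω}
    {τ : Ω → ℝ} {t : ℝ} {A : Set Ω}
    (hA : MeasurableSet[m ⊔ MeasurableSpace.generateFrom {A | ∃ u ≤ t, A = {ω | τ ω ≤ u}}] A) :
    ∃ B, MeasurableSet[m] B ∧ A ∩ τ ⁻¹' Set.Ioi t = B ∩ τ ⁻¹' Set.Ioi t := by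
  let m' : MeasurableSpace Ω :=
    { MeasurableSet' := fun A =>
        ∃ B, MeasurableSet[m] B ∧ A ∩ τ ⁻¹' Set.Ioi t = B ∩ τ ⁻¹' Set.Ioi t
      measurableSet_empty := ⟨∅, MeasurableSet.empty, rfl⟩
      measurableSet_compl := by
        rintro A ⟨B, hB, h⟩
        refine ⟨Bᶜ, hB.compl, ?_⟩
        ext ω
        have := Set.ext_iff.1 h ω
        simp only [Set.mem_inter_iff, Set.mem_compl_iff] at this ⊢
        tauto
      measurableSet_iUnion := by
        intro F hF
        choose B hB h using hF
        refine ⟨⋃ i, B i, MeasurableSet.iUnion hB, ?_⟩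
        simp_rw [Set.iUnion_inter, h] }
  have hle : m ⊔ MeasurableSpace.generateFrom {A | ∃ u ≤ t, A = {ω | τ ω ≤ u}} ≤ m' := by
    refine sup_le (fun A hA => ⟨A, hA, rfl⟩) (MeasurableSpace.generateFrom_le ?_)
    rintro A ⟨u, hu, rfl⟩
    refine ⟨∅, @MeasurableSet.empty _ m, ?_⟩
    ext ω
    simp only [Set.mem_inter_iff, Set.mem_ofPred_eq, Set.mem_preimage, Set.mem_Ioi,
      Set.mem_empty_iff_false, false_and, iff_false, not_and, not_lt]
    exact fun h => h.trans hu
  exact hle A hA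

/-- With an absolutely continuous hazard process `Γ_s = ∫_0^s λ_u du` (λ nonnegative,
progressively measurable) and a bounded càdlàg `ℱ`-martingale `M` on `[t,T]` which a.s.
does not jump at `τ`, almost surely
`E[M_τ 1_{t<τ≤T} | 𝒢_t] = 1_{τ>t} · E[ ∫_t^T M_s λ_s e^{-(Γ_s - Γ_t)} ds | ℱ_t ]`. -/
theorem stmt5
    {Ω : Type*} {mΩ : MeasurableSpace Ω} (P : Measure Ω) [IsProbabilityMeasure P]
    (T : ℝ) (hT : 0 ≤ T)
    (ℱ : Filtration ℝ mΩ)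
    (τ : Ω → ℝ) (hτmeas : Measurable τ) (hτpos : ∀ ω, 0 < τ ω)
    (𝒢 : ℝ → MeasurableSpace Ω)
    (h𝒢 : ∀ s, 𝒢 s = (ℱ s : MeasurableSpace Ω) ⊔
      MeasurableSpace.generateFrom {A | ∃ u ≤ s, A = {ω | τ ω ≤ u}})
    (h𝒢le : ∀ s, 𝒢 s ≤ mΩ)
    -- nonnegative progressively measurable intensity, locally integrable in time
    (lam : ℝ → Ω → ℝ) (hlam_nonneg : ∀ s ω, 0 ≤ lam s ω)
    (hlam_prog : ProgMeasurable ℱ lam)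
    (hlam_int : ∀ᵐ ω ∂P, IntegrableOn (fun u => lam u ω) (Set.Icc 0 T) volume)
    -- the hazard process `Γ_s = -ln(1 - F_s)` is absolutely continuous with density `λ`
    (Γ : ℝ → Ω → ℝ)
    (hΓ : ∀ᵐ ω ∂P, ∀ s ∈ Set.Icc (0 : ℝ) T, Γ s ω = ∫ u in (0 : ℝ)..s, lam u ω)
    (hFΓ : ∀ s, (fun ω => 1 - Real.exp (-Γ s ω)) =ᵐ[P]
      P[Set.indicator (τ ⁻¹' Set.Iic s) (fun _ => (1 : ℝ)) | ℱ s])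
    (t : ℝ) (ht : 0 ≤ t) (htT : t ≤ T)
    -- a bounded càdlàg `ℱ`-martingale on `[t,T]` which a.s. does not jump at `τ`
    (M : ℝ → Ω → ℝ)
    (hadapted : ∀ s ∈ Set.Icc t T, StronglyMeasurable[ℱ s] (M s))
    (hbdd : ∃ C, ∀ s ∈ Set.Icc t T, ∀ ω, |M s ω| ≤ C)
    (hmart : ∀ u ∈ Set.Icc t T, ∀ v ∈ Set.Icc t T, u ≤ v →
      P[M v | ℱ u] =ᵐ[P] M u)
    (hrc : ∀ ω, ∀ u ∈ Set.Ico t T,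
      ContinuousWithinAt (fun s => M s ω) (Set.Icc u T) u)
    (hll : ∀ ω, ∀ u ∈ Set.Ioc t T,
      ∃ l, Filter.Tendsto (fun s => M s ω) (nhdsWithin u (Set.Iio u)) (nhds l))
    (hnojump : ∀ᵐ ω ∂P, Filter.Tendsto (fun s => M s ω)
      (nhdsWithin (τ ω) (Set.Iio (τ ω))) (nhds (M (τ ω) ω))) :
    P[fun ω => Set.indicator (τ ⁻¹' Set.Ioc t T) (fun ω' => M (τ ω') ω') ω | 𝒢 t]
      =ᵐ[P] fun ω => Set.indicator (τ ⁻¹' Set.Ioi t) (fun _ => (1 : ℝ)) ω *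
        (P[fun ω' => ∫ s in t..T,
            M s ω' * lam s ω' * Real.exp (-(Γ s ω' - Γ t ω')) | ℱ t]) ω := by
  classical
  obtain ⟨C, hC⟩ := hbdd
  set E : ℝ → Ω → ℝ := fun s ω => Real.exp (-Γ s ω) with hE
  set J : ℝ → Ω → ℝ := fun s => Set.indicator (τ ⁻¹' Set.Iic s) (fun _ => (1 : ℝ)) with hJ
  set p := gridPoint t T with hp
  have hJm : ∀ s, Measurable (J s) := fun s =>
    measurable_const.indicator (hτmeas measurableSet_Iic)
  have hJ1 : ∀ s ω, |J s ω| ≤ 1 := fun s ω => by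
    simp only [hJ, Set.indicator_apply]; split_ifs <;> simp
  have hJi : ∀ s, Integrable (J s) P := fun s =>
    Integrable.of_bound (hJm s).aestronglyMeasurable 1 (Filter.Eventually.of_forall (hJ1 s))
  have hEm : ∀ s, AEStronglyMeasurable[ℱ s] (E s) P := fun s => by
    have h1 : AEStronglyMeasurable[ℱ s] (fun ω => 1 - P[J s | ℱ s] ω) P :=
      (stronglyMeasurable_const.sub stronglyMeasurable_condExp).aestronglyMeasurable
    refine h1.congr ?_
    filter_upwards [hFΓ s] with ω hω
    rw [← hω]; ring
  have hEm0 : ∀ s, AEStronglyMeasurable (E s) P := fun s => (hEm s).mono (ℱ.le s)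
  have hE1 : ∀ s ∈ Set.Icc 0 T, ∀ᵐ ω ∂P, |E s ω| ≤ 1 := fun s hs => by
    filter_upwards [hΓ] with ω hω
    rw [abs_of_pos (Real.exp_pos _), Real.exp_le_one_iff, hω s hs, neg_nonpos]
    exact intervalIntegral.integral_nonneg hs.1 fun u _ => hlam_nonneg u ω
  have hpm : ∀ n i, i ≤ n + 1 → p n i ∈ Set.Icc t T := fun n i hi => gridPoint_mem_Icc htT hi
  have hsub : Set.Icc t T ⊆ Set.Icc 0 T := Set.Icc_subset_Icc_left ht
  -- the two sides and their discretizations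
  set Y : Ω → ℝ := fun ω => Set.indicator (τ ⁻¹' Set.Ioc t T) (fun ω' => M (τ ω') ω') ω with hY
  set Yn : ℕ → Ω → ℝ := fun n ω => leftStep (fun s => M s ω) t T n (τ ω) with hYn
  set W : Ω → ℝ := fun ω => ∫ s in t..T, M s ω *
    (lam s ω * Real.exp (-∫ u in (0 : ℝ)..s, lam u ω)) with hW
  set Wn : ℕ → Ω → ℝ := fun n ω => ∑ i ∈ Finset.range (n + 1),
    M (p n i) ω * (E (p n i) ω - E (p n (i + 1)) ω) with hWn
  set V : Ω → ℝ := fun ω' => ∫ s in t..T,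
    M s ω' * lam s ω' * Real.exp (-(Γ s ω' - Γ t ω')) with hV
  have hYn_eq : ∀ n ω, Yn n ω = ∑ i ∈ Finset.range (n + 1),
      M (p n i) ω * (J (p n (i + 1)) ω - J (p n i) ω) := fun n ω => by
    refine Finset.sum_congr rfl fun i _ => ?_
    have hmono : p n i ≤ p n (i + 1) := monotone_gridPoint htT n (Nat.le_succ i)
    simp only [hJ, Set.indicator_apply, Set.mem_preimage, Set.mem_Ioc, Set.mem_Iic, ← hp]
    by_cases h1 : τ ω ≤ p n i
    · simp [h1, h1.trans hmono]
    · by_cases h2 : τ ω ≤ p n (i + 1)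
      · simp [h1, h2, not_le.1 h1]
      · simp [h1, h2]
  have hMm : ∀ s ∈ Set.Icc t T, Measurable (M s) := fun s hs =>
    ((hadapted s hs).mono (ℱ.le s)).measurable
  have hYnm : ∀ n, AEStronglyMeasurable (Yn n) P := fun n => by
    rw [funext (hYn_eq n)]
    refine (Finset.measurable_sum _ fun i hi => ?_).aestronglyMeasurable
    exact (hMm _ (hpm n i (Finset.mem_range.1 hi).le)).mul ((hJm _).sub (hJm _))
  have hYnC : ∀ n ω, |Yn n ω| ≤ C := fun n ω => abs_leftStep_le htT (fun s hs => hC s hs ω) n _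
  have hYlim : ∀ᵐ ω ∂P, Filter.Tendsto (fun n => Yn n ω) Filter.atTop (nhds (Y ω)) := by
    filter_upwards [hnojump] with ω hω
    by_cases hmem : τ ω ∈ Set.Ioc t T
    · have : Y ω = M (τ ω) ω := Set.indicator_of_mem (s := τ ⁻¹' Set.Ioc t T) hmem _
      rw [this]
      exact tendsto_leftStep hmem hω
    · have : Y ω = 0 := Set.indicator_of_notMem (s := τ ⁻¹' Set.Ioc t T) hmem _
      simp only [this, hYn, leftStep_eq_zero htT _ hmem]
      exact tendsto_const_nhds
  have hYC : ∀ᵐ ω ∂P, |Y ω| ≤ C := by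
    filter_upwards [hYlim] with ω hω
    exact le_of_tendsto hω.abs (Filter.Eventually.of_forall fun n => hYnC n ω)
  have hYi : Integrable Y P :=
    Integrable.of_bound (aestronglyMeasurable_of_tendsto_ae _ hYnm hYlim) C hYC
  have hWlim : ∀ᵐ ω ∂P, Filter.Tendsto (fun n => Wn n ω) Filter.atTop (nhds (W ω)) ∧
      |W ω| ≤ C * (E t ω - E T ω) := by
    filter_upwards [hΓ, hlam_int] with ω hω hint
    have h := tendsto_sum_mul_exp_neg_primitive (f := fun s => M s ω) (fun s => hlam_nonneg s ω) hint
      ht htT le_rfl (fun s hs => hC s hs ω) (hll ω)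
    refine ⟨h.1.congr fun n => Finset.sum_congr rfl fun i hi => ?_, ?_⟩
    · have hi' := Finset.mem_range.1 hi
      simp only [hE]
      rw [hω _ (hsub (hpm n i hi'.le)), hω _ (hsub (hpm n (i + 1) hi'))]
    · simp only [hE]
      rw [hω _ ⟨ht, htT⟩, hω _ ⟨hT, le_rfl⟩]
      exact h.2
  have hC0 : ∀ ω, 0 ≤ C := fun ω => (abs_nonneg _).trans (hC t ⟨le_rfl, htT⟩ ω)
  have hWnm : ∀ n, AEStronglyMeasurable (Wn n) P := fun n => by
    refine Finset.aestronglyMeasurable_fun_sum _ fun i hi => ?_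
    exact (hMm _ (hpm n i (Finset.mem_range.1 hi).le)).aestronglyMeasurable.mul
      ((hEm0 _).sub (hEm0 _))
  have hWnC : ∀ n, ∀ᵐ ω ∂P, |Wn n ω| ≤ C := fun n => by
    filter_upwards [hΓ, hlam_int, hE1 t ⟨ht, htT⟩] with ω hω hint h1
    have hle : |Wn n ω| ≤ ∑ i ∈ Finset.range (n + 1), C * (E (p n i) ω - E (p n (i + 1)) ω) := by
      refine (Finset.abs_sum_le_sum_abs _ _).trans (Finset.sum_le_sum fun i hi => ?_)
      have hi' := Finset.mem_range.1 hi
      have ha := hpm n i hi'.le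
      have hb := hpm n (i + 1) hi'
      have hmono : p n i ≤ p n (i + 1) := monotone_gridPoint htT n (Nat.le_succ i)
      have h0 : 0 ≤ E (p n i) ω - E (p n (i + 1)) ω := by
        simp only [hE]
        rw [hω _ (hsub ha), hω _ (hsub hb), ← (integral_mul_exp_neg_primitive
          (fun s => hlam_nonneg s ω) hint (ht.trans ha.1) hmono hb.2).2]
        exact intervalIntegral.integral_nonneg hmono fun u _ =>
          mul_nonneg (hlam_nonneg u ω) (Real.exp_pos _).le
      rw [abs_mul, abs_of_nonneg h0]
      exact mul_le_mul_of_nonneg_right (hC _ ha ω) h0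
    rw [← Finset.mul_sum, Finset.sum_range_sub' (fun i => E (p n i) ω), hp, gridPoint_zero] at hle
    have h2 : 0 < E (gridPoint t T n (n + 1)) ω := Real.exp_pos _
    have h3 := (abs_le.1 h1).2
    nlinarith [hC0 ω]
  have hWm : AEStronglyMeasurable W P :=
    aestronglyMeasurable_of_tendsto_ae _ hWnm (hWlim.mono fun _ h => h.1)
  have hVW : ∀ᵐ ω ∂P, E t ω * V ω = W ω ∧ |V ω| ≤ C := by
    filter_upwards [hΓ, hWlim] with ω hω hlim
    have hEV : E t ω * V ω = W ω := by
      rw [hV, hW, ← intervalIntegral.integral_const_mul]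
      refine intervalIntegral.integral_congr fun s hs => ?_
      rw [Set.uIcc_of_le htT] at hs
      simp only [hE]
      rw [← hω s (hsub hs), neg_sub, sub_eq_add_neg, Real.exp_add, Real.exp_neg (Γ t ω)]
      field_simp
    refine ⟨hEV, ?_⟩
    have hpos : 0 < E t ω := Real.exp_pos _
    have h2 : 0 < E T ω := Real.exp_pos _
    have h3 := hlim.2
    rw [← hEV, abs_mul, abs_of_pos hpos] at h3
    have : E t ω * |V ω| ≤ E t ω * C := by nlinarith [hC0 ω]
    exact le_of_mul_le_mul_left this hpos
  have hVm : AEStronglyMeasurable V P := by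
    have h1 : AEStronglyMeasurable (fun ω => (E t ω)⁻¹ * W ω) P :=
      ((hEm0 t).aemeasurable.inv.mul hWm.aemeasurable).aestronglyMeasurable
    refine h1.congr ?_
    filter_upwards [hVW] with ω hω
    have hpos : E t ω ≠ 0 := (Real.exp_pos _).ne'
    rw [← hω.1, inv_mul_cancel_left₀ hpos]
  have hVi : Integrable V P := Integrable.of_bound hVm C (hVW.mono fun _ h => h.2)
  set Z : Ω → ℝ := P[V | ℱ t] with hZ
  have hZC : ∀ᵐ ω ∂P, |Z ω| ≤ C :=
    ae_bdd_abs_condExp_of_ae_bdd_abs (hVW.mono fun _ h => h.2)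
  -- the discretized identity
  have hpair : ∀ (X : Ω → ℝ) (s : ℝ), StronglyMeasurable[ℱ s] X → (∀ ω, |X ω| ≤ C) →
      ∫ ω, X ω * J s ω ∂P = ∫ ω, X ω * (1 - E s ω) ∂P := fun X s hX hXC =>
    integral_mul_eq_integral_mul_of_ae_eq_condExp (ℱ.le s) hX.aestronglyMeasurable
      (Filter.Eventually.of_forall hXC) (hJi s) (hFΓ s)
  have hdisc : ∀ B, MeasurableSet[ℱ t] B → ∀ n, ∫ ω in B, Yn n ω ∂P = ∫ ω in B, Wn n ω ∂P := by
    intro B hB n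
    have hB0 := ℱ.le t B hB
    rw [← integral_indicator hB0, ← integral_indicator hB0]
    have e1 : ∀ ω, B.indicator (Yn n) ω = ∑ i ∈ Finset.range (n + 1),
        (B.indicator (M (p n i)) ω * J (p n (i + 1)) ω - B.indicator (M (p n i)) ω * J (p n i) ω) := by
      intro ω
      by_cases hω : ω ∈ B
      · simp only [Set.indicator_of_mem hω, hYn_eq, mul_sub]
      · simp [Set.indicator_of_notMem hω]
    have e2 : ∀ ω, B.indicator (Wn n) ω = ∑ i ∈ Finset.range (n + 1),
        (B.indicator (M (p n i)) ω * (1 - E (p n (i + 1)) ω) -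
          B.indicator (M (p n i)) ω * (1 - E (p n i) ω)) := by
      intro ω
      by_cases hω : ω ∈ B
      · simp only [Set.indicator_of_mem hω, hWn]
        exact Finset.sum_congr rfl fun i _ => by ring
      · simp [Set.indicator_of_notMem hω]
    have hXm : ∀ i ∈ Finset.range (n + 1), ∀ s, p n i ≤ s →
        StronglyMeasurable[ℱ s] (B.indicator (M (p n i))) := fun i hi s hs => by
      have hm := hpm n i (Finset.mem_range.1 hi).le
      exact ((hadapted _ hm).mono (ℱ.mono hs)).indicator (ℱ.mono (hm.1.trans hs) B hB)
    have hXC : ∀ i ∈ Finset.range (n + 1), ∀ ω, |B.indicator (M (p n i)) ω| ≤ C := fun i hi ω => by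
      by_cases hω : ω ∈ B
      · rw [Set.indicator_of_mem hω]; exact hC _ (hpm n i (Finset.mem_range.1 hi).le) ω
      · rw [Set.indicator_of_notMem hω, abs_zero]; exact hC0 ω
    have hXi : ∀ i ∈ Finset.range (n + 1), ∀ g : Ω → ℝ, Integrable g P →
        Integrable (fun ω => B.indicator (M (p n i)) ω * g ω) P := fun i hi g hg =>
      hg.bdd_mul ((hXm i hi _ le_rfl).mono (ℱ.le _)).aestronglyMeasurable
        (Filter.Eventually.of_forall (hXC i hi))
    have hEi : ∀ s ∈ Set.Icc t T, Integrable (fun ω => 1 - E s ω) P := fun s hs =>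
      (integrable_const 1).sub (Integrable.of_bound (hEm0 s) 1 (hE1 s (hsub hs)))
    rw [integral_congr_ae (Filter.Eventually.of_forall e1),
      integral_congr_ae (Filter.Eventually.of_forall e2), integral_finsetSum, integral_finsetSum]
    · refine Finset.sum_congr rfl fun i hi => ?_
      have hi' := Finset.mem_range.1 hi
      have hmono : p n i ≤ p n (i + 1) := monotone_gridPoint htT n (Nat.le_succ i)
      rw [integral_sub (hXi i hi _ (hJi _)) (hXi i hi _ (hJi _)),
        integral_sub (hXi i hi _ (hEi _ (hpm n (i + 1) hi'))) (hXi i hi _ (hEi _ (hpm n i hi'.le))),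
        hpair _ _ (hXm i hi _ hmono) (hXC i hi), hpair _ _ (hXm i hi _ le_rfl) (hXC i hi)]
    · intro i hi
      have hi' := Finset.mem_range.1 hi
      exact (hXi i hi _ (hEi _ (hpm n (i + 1) hi'))).sub (hXi i hi _ (hEi _ (hpm n i hi'.le)))
    · intro i hi
      exact (hXi i hi _ (hJi _)).sub (hXi i hi _ (hJi _))
  have hlimit : ∀ B, MeasurableSet[ℱ t] B → ∫ ω in B, Y ω ∂P = ∫ ω in B, W ω ∂P := by
    intro B hB
    have l1 : Filter.Tendsto (fun n => ∫ ω in B, Yn n ω ∂P) Filter.atTop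
        (nhds (∫ ω in B, Y ω ∂P)) :=
      tendsto_integral_of_dominated_convergence (fun _ => C) (fun n => (hYnm n).restrict)
        (integrable_const C) (fun n => Filter.Eventually.of_forall (hYnC n))
        (ae_restrict_of_ae hYlim)
    have l2 : Filter.Tendsto (fun n => ∫ ω in B, Wn n ω ∂P) Filter.atTop
        (nhds (∫ ω in B, W ω ∂P)) :=
      tendsto_integral_of_dominated_convergence (fun _ => C) (fun n => (hWnm n).restrict)
        (integrable_const C) (fun n => ae_restrict_of_ae (hWnC n))
        (ae_restrict_of_ae (hWlim.mono fun _ h => h.1))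
    simp_rw [hdisc B hB] at l1
    exact tendsto_nhds_unique l1 l2
  -- identification of the conditional expectation
  have hI : ∀ ω, Set.indicator (τ ⁻¹' Set.Ioi t) (fun _ => (1 : ℝ)) ω = 1 - J t ω := fun ω => by
    by_cases h : τ ω ≤ t
    · simp [hJ, h]
    · simp [hJ, h, not_le.1 h]
  have hℱ𝒢 : (ℱ t : MeasurableSpace Ω) ≤ 𝒢 t := by rw [h𝒢 t]; exact le_sup_left
  have hIm : Measurable[𝒢 t] (Set.indicator (τ ⁻¹' Set.Ioi t) (fun _ => (1 : ℝ))) := by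
    refine Measurable.indicator measurable_const ?_
    have hle : MeasurableSet[𝒢 t] {ω | τ ω ≤ t} := by
      rw [h𝒢 t]
      exact le_sup_right (a := (ℱ t : MeasurableSpace Ω)) _
        (MeasurableSpace.measurableSet_generateFrom ⟨t, le_rfl, rfl⟩)
    have : τ ⁻¹' Set.Ioi t = {ω | τ ω ≤ t}ᶜ := by ext ω; simp
    rw [this]; exact hle.compl
  set R : Ω → ℝ := fun ω => Set.indicator (τ ⁻¹' Set.Ioi t) (fun _ => (1 : ℝ)) ω * Z ω with hR
  have hZm : StronglyMeasurable[ℱ t] Z := stronglyMeasurable_condExp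
  have hRm : StronglyMeasurable[𝒢 t] R := hIm.stronglyMeasurable.mul (hZm.mono hℱ𝒢)
  have hRi : Integrable R P := by
    refine Integrable.of_bound (hRm.mono (h𝒢le t)).aestronglyMeasurable C ?_
    filter_upwards [hZC] with ω hω
    simp only [hR, Set.indicator_apply]
    split_ifs
    · simpa using hω
    · simpa using hC0 ω
  refine (ae_eq_condExp_of_forall_setIntegral_eq (h𝒢le t) hYi (fun _ _ _ => hRi.integrableOn) ?_
    hRm.aestronglyMeasurable).symm
  intro A hA _
  rw [h𝒢 t] at hA
  have hA0 : MeasurableSet A := h𝒢le t A (by rw [h𝒢 t]; exact hA)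
  obtain ⟨B, hB, hAB⟩ := exists_measurableSet_inter_preimage_Ioi_eq hA
  have hB0 := ℱ.le t B hB
  have hswap : ∀ f : Ω → ℝ, (∀ ω, τ ω ≤ t → f ω = 0) → ∫ ω in A, f ω ∂P = ∫ ω in B, f ω ∂P := by
    intro f hf
    rw [← integral_indicator hA0, ← integral_indicator hB0]
    congr 1
    ext ω
    by_cases hω : τ ω ≤ t
    · simp [Set.indicator_apply, hf ω hω]
    · have := Set.ext_iff.1 hAB ω
      simp only [Set.mem_inter_iff, Set.mem_preimage, Set.mem_Ioi, not_le.1 hω, and_true] at this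
      simp only [Set.indicator_apply, this]
  rw [hswap R fun ω hω => by simp [hR, Set.indicator_apply, not_lt.2 hω],
    hswap Y fun ω hω => by simp [hY, Set.indicator_apply, not_lt.2 hω], hlimit B hB,
    ← integral_indicator hB0, ← integral_indicator hB0]
  have hBZ : StronglyMeasurable[ℱ t] (B.indicator Z) := hZm.indicator hB
  have hBZC : ∀ᵐ ω ∂P, |B.indicator Z ω| ≤ C := by
    filter_upwards [hZC] with ω hω
    simp only [Set.indicator_apply]
    split_ifs
    · exact hω
    · simpa using hC0 ω
  have hBE : AEStronglyMeasurable[ℱ t] (B.indicator (E t)) P :=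
    ((hEm t).stronglyMeasurable_mk.indicator hB).aestronglyMeasurable.congr
      (by filter_upwards [(hEm t).ae_eq_mk] with ω hω; simp only [Set.indicator_apply, hω])
  have hBE1 : ∀ᵐ ω ∂P, |B.indicator (E t) ω| ≤ 1 := by
    filter_upwards [hE1 t ⟨ht, htT⟩] with ω hω
    simp only [Set.indicator_apply]
    split_ifs
    · exact hω
    · simp
  have hcompl : (fun ω => E t ω) =ᵐ[P] P[fun ω => 1 - J t ω | ℱ t] := by
    have h1 := condExp_sub (integrable_const (1 : ℝ)) (hJi t) (ℱ t)
    rw [condExp_const (ℱ.le t)] at h1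
    filter_upwards [hFΓ t, h1] with ω h2 h3
    have h4 : P[fun ω => 1 - J t ω | ℱ t] ω = 1 - P[J t | ℱ t] ω := h3
    rw [h4, ← h2]; simp [hE]
  calc ∫ ω, B.indicator R ω ∂P = ∫ ω, B.indicator Z ω * (1 - J t ω) ∂P := by
        refine integral_congr_ae (Filter.Eventually.of_forall fun ω => ?_)
        by_cases hω : ω ∈ B
        · simp only [Set.indicator_of_mem hω, hR, hI]; ring
        · simp [Set.indicator_of_notMem hω]
    _ = ∫ ω, B.indicator Z ω * E t ω ∂P :=
        integral_mul_eq_integral_mul_of_ae_eq_condExp (ℱ.le t) hBZ.aestronglyMeasurable hBZC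
          ((integrable_const 1).sub (hJi t)) hcompl
    _ = ∫ ω, B.indicator (E t) ω * Z ω ∂P := by
        refine integral_congr_ae (Filter.Eventually.of_forall fun ω => ?_)
        by_cases hω : ω ∈ B
        · simp only [Set.indicator_of_mem hω]; ring
        · simp [Set.indicator_of_notMem hω]
    _ = ∫ ω, B.indicator (E t) ω * V ω ∂P :=
        (integral_mul_eq_integral_mul_of_ae_eq_condExp (ℱ.le t) hBE hBE1
          hVi Filter.EventuallyEq.rfl).symm
    _ = ∫ ω, B.indicator W ω ∂P := by
        refine integral_congr_ae ?_
        filter_upwards [hVW] with ω hVω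
        by_cases hω : ω ∈ B
        · simp only [Set.indicator_of_mem hω, hVω.1]
        · simp [Set.indicator_of_notMem hω]
end

section
/- Under fractional recovery Z_s = R·c(s,T) with constant 0 ≤ R < 1, where c(s,T) = E[B(s,T) ξ | ℱ_s] is the default-free price, and assuming the hypotheses guaranteeing the representation c^d(t,T) = 1_{τ>t} E[e^{-∫_t^T(r+λ)}ξ + ∫_t^T Z_s λ_s e^{-∫_t^s(r+λ)}ds | ℱ_t], one has almost surely c^d(t,T) = 1_{τ>t} [ R·E(e^{-∫_t^T r_u du} ξ | ℱ_t) + (1−R)·E(e^{-∫_t^T (r_u+λ_u) du} ξ | ℱ_t) ]. -/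
open MeasureTheory

theorem AbsolutelyContinuousOnInterval.of_dist_le {X Y : Type*} [PseudoMetricSpace X]
    [PseudoMetricSpace Y] {f : ℝ → X} {g : ℝ → Y} {a b : ℝ}
    (hf : AbsolutelyContinuousOnInterval f a b)
    (h : ∀ x ∈ Set.uIcc a b, ∀ y ∈ Set.uIcc a b, dist (g x) (g y) ≤ dist (f x) (f y)) :
    AbsolutelyContinuousOnInterval g a b := by
  rw [absolutelyContinuousOnInterval_iff] at hf ⊢
  intro ε hε
  obtain ⟨δ, hδ, H⟩ := hf ε hε
  exact ⟨δ, hδ, fun E hE hlt => (Finset.sum_le_sum fun i hi =>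
    h _ (hE.1 i hi).1 _ (hE.1 i hi).2).trans_lt (H E hE hlt)⟩

theorem Real.abs_exp_neg_sub_exp_neg_le {x y : ℝ} (hx : 0 ≤ x) (hy : 0 ≤ y) :
    |Real.exp (-x) - Real.exp (-y)| ≤ |x - y| := by
  wlog hxy : x ≤ y generalizing x y
  · rw [abs_sub_comm, abs_sub_comm x]
    exact this hy hx (le_of_not_ge hxy)
  have h1 : Real.exp (-y) ≤ Real.exp (-x) := Real.exp_le_exp.2 (by linarith)
  have h2 : Real.exp (-x) ≤ 1 := Real.exp_le_one_iff.2 (by linarith)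
  have h3 : Real.exp (-y) = Real.exp (-x) * Real.exp (-(y - x)) := by
    rw [← Real.exp_add]; ring_nf
  have h4 := Real.add_one_le_exp (-(y - x))
  rw [abs_of_nonneg (by linarith), abs_sub_comm, abs_of_nonneg (by linarith), h3]
  nlinarith [Real.exp_pos (-x)]

theorem integral_mul_exp_neg_integral {f : ℝ → ℝ} {a b : ℝ} (hab : a ≤ b) (hf0 : ∀ x, 0 ≤ f x)
    (hf : IntervalIntegrable f volume a b) :
    ∫ s in a..b, f s * Real.exp (-(∫ u in a..s, f u)) = 1 - Real.exp (-(∫ u in a..b, f u)) := by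
  have hpos : ∀ x ∈ Set.uIcc a b, 0 ≤ ∫ u in a..x, f u := fun x hx => by
    rw [Set.uIcc_of_le hab] at hx
    exact intervalIntegral.integral_nonneg hx.1 fun u _ => hf0 u
  have hac : AbsolutelyContinuousOnInterval (fun x => Real.exp (-(∫ u in a..x, f u))) a b :=
    (hf.absolutelyContinuousOnInterval_intervalIntegral (c := a) (by simp)).of_dist_le
      fun x hx y hy => Real.abs_exp_neg_sub_exp_neg_le (hpos x hx) (hpos y hy)
  have hmain := hac.integral_deriv_eq_sub
  have hcongr : ∫ s in a..b, deriv (fun x => Real.exp (-(∫ u in a..x, f u))) s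
      = ∫ s in a..b, -(f s * Real.exp (-(∫ u in a..s, f u))) := by
    refine intervalIntegral.integral_congr_ae ?_
    filter_upwards [hf.ae_hasDerivAt_integral] with x hx hxm
    have hd : HasDerivAt (fun x => Real.exp (-(∫ u in a..x, f u)))
        (Real.exp (-(∫ u in a..x, f u)) * -f x) x :=
      (hx (Set.uIoc_subset_uIcc hxm) a (by simp)).neg.exp
    rw [hd.deriv]
    ring
  rw [hcongr, intervalIntegral.integral_neg] at hmain
  simp only [intervalIntegral.integral_same, neg_zero, Real.exp_zero] at hmain
  linarith

theorem intervalIntegrable_mul_exp_neg_integral {f : ℝ → ℝ} {a b : ℝ}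
    (hf : IntervalIntegrable f volume a b) :
    IntervalIntegrable (fun s => f s * Real.exp (-(∫ u in a..s, f u))) volume a b := by
  refine hf.mul_continuousOn (Real.continuous_exp.comp_continuousOn ?_)
  exact (hf.absolutelyContinuousOnInterval_intervalIntegral (c := a) (by simp)).continuousOn.neg

theorem stronglyMeasurable_intervalIntegral_prod {Ω : Type*} [MeasurableSpace Ω]
    {f : ℝ → Ω → ℝ} (hf : StronglyMeasurable (Function.uncurry f)) (a : ℝ) :
    StronglyMeasurable fun p : ℝ × Ω => ∫ u in a..p.1, f u p.2 := by
  have h1 : StronglyMeasurable fun q : (ℝ × Ω) × ℝ => f q.2 q.1.2 :=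
    hf.comp_measurable (g := fun q : (ℝ × Ω) × ℝ => (q.2, q.1.2)) (by fun_prop)
  have key : ∀ S : Set ((ℝ × Ω) × ℝ), MeasurableSet S →
      StronglyMeasurable fun p : ℝ × Ω => ∫ u, S.indicator (fun q => f q.2 q.1.2) (p, u) :=
    fun S hS => (h1.indicator hS).integral_prod_right'
  have hA := key ({q | a < q.2} ∩ {q | q.2 ≤ q.1.1})
    ((measurableSet_lt (by fun_prop) (by fun_prop)).inter
      (measurableSet_le (by fun_prop) (by fun_prop)))
  have hB := key ({q | q.1.1 < q.2} ∩ {q | q.2 ≤ a})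
    ((measurableSet_lt (by fun_prop) (by fun_prop)).inter
      (measurableSet_le (by fun_prop) (by fun_prop)))
  convert hA.sub hB using 1
  ext p
  simp only [intervalIntegral, Pi.sub_apply, ← integral_indicator measurableSet_Ioc]
  rfl

theorem stronglyMeasurable_uncurry_min {Ω : Type*} [MeasurableSpace Ω] {i : ℝ} {f : ℝ → Ω → ℝ}
    (hf : StronglyMeasurable fun p : Set.Iic i × Ω => f p.1 p.2) :
    StronglyMeasurable (Function.uncurry fun s ω => f (min s i) ω) :=
  hf.comp_measurable
    (g := fun p : ℝ × Ω => ((⟨min p.1 i, Set.mem_Iic.2 (min_le_right _ _)⟩ : Set.Iic i), p.2))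
    (by fun_prop)

theorem stronglyMeasurable_intervalIntegral_Iic {Ω : Type*} [MeasurableSpace Ω] {s t : ℝ}
    {f : ℝ → Ω → ℝ} (hf : StronglyMeasurable fun p : Set.Iic s × Ω => f p.1 p.2) (hts : t ≤ s) :
    StronglyMeasurable fun ω => ∫ v in t..s, f v ω := by
  have h : StronglyMeasurable fun ω => ∫ v in t..s, f (min v s) ω :=
    (stronglyMeasurable_intervalIntegral_prod (stronglyMeasurable_uncurry_min hf) t).comp_measurable
      (measurable_prodMk_left (x := s))
  convert h using 2 with ω
  refine intervalIntegral.integral_congr fun v hv => ?_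
  rw [Set.uIcc_of_le hts] at hv
  simp [min_eq_left hv.2]

namespace MeasureTheory.IsStronglyProgressive

variable {Ω : Type*} {mΩ : MeasurableSpace Ω} {ℱ : Filtration ℝ mΩ} {f : ℝ → Ω → ℝ}

theorem stronglyMeasurable_intervalIntegral (hf : IsStronglyProgressive ℱ f) {t s : ℝ}
    (hts : t ≤ s) : StronglyMeasurable[ℱ s] fun ω => ∫ v in t..s, f v ω :=
  @stronglyMeasurable_intervalIntegral_Iic Ω (ℱ s) s t f (hf s) hts

theorem stronglyMeasurable_uncurry_comp_min (hf : IsStronglyProgressive ℱ f) (T : ℝ) :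
    StronglyMeasurable (Function.uncurry fun s ω => f (min s T) ω) :=
  StronglyMeasurable.mono (@_root_.stronglyMeasurable_uncurry_min Ω (ℱ T) T f (hf T))
    (sup_le_sup le_rfl (MeasurableSpace.comap_mono (ℱ.le T)))

theorem comp_min (hf : IsStronglyProgressive ℱ f) (T : ℝ) :
    IsStronglyProgressive ℱ fun s ω => f (min s T) ω :=
  hf.comp (t := fun s _ => min s T) (fun i => by
    refine Measurable.stronglyMeasurable ?_
    exact (measurable_subtype_coe.comp measurable_fst).min measurable_const)
    fun _ _ => min_le_left _ _

end MeasureTheory.IsStronglyProgressive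

theorem intervalIntegrable_of_abs_le {f : ℝ → ℝ} {C : ℝ} (hf : StronglyMeasurable f)
    (hC : ∀ s, |f s| ≤ C) {a b : ℝ} : IntervalIntegrable f volume a b :=
  (intervalIntegrable_const (c := C)).mono_fun hf.aestronglyMeasurable
    (.of_forall fun s => (hC s).trans (le_abs_self C))

theorem Real.exp_neg_intervalIntegral_le {f : ℝ → ℝ} {a b C L : ℝ} (hab : a ≤ b) (hL : b - a ≤ L)
    (hf : ∀ s, |f s| ≤ C) : Real.exp (-(∫ u in a..b, f u)) ≤ Real.exp (C * L) := by
  have hC : 0 ≤ C := (abs_nonneg _).trans (hf a)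
  have h := intervalIntegral.norm_integral_le_of_norm_le_const (a := a) (b := b) (f := f)
    fun s _ => hf s
  rw [Real.norm_eq_abs, abs_of_nonneg (sub_nonneg.2 hab)] at h
  exact Real.exp_le_exp.2 ((neg_le_abs _).trans (h.trans (mul_le_mul_of_nonneg_left hL hC)))

theorem integrable_prod_mul_exp_neg_integral {Ω : Type*} {mΩ : MeasurableSpace Ω} {P : Measure Ω}
    [IsFiniteMeasure P] {lam : ℝ → Ω → ℝ} {t T : ℝ} (htT : t ≤ T)
    (hlam : StronglyMeasurable (Function.uncurry lam)) (hlam0 : ∀ s ω, 0 ≤ lam s ω)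
    (hlam_int : ∀ ω, IntervalIntegrable (fun u => lam u ω) volume t T) :
    Integrable (fun p : ℝ × Ω => lam p.1 p.2 * Real.exp (-(∫ u in t..p.1, lam u p.2)))
      ((volume.restrict (Set.Ioc t T)).prod P) := by
  have hsm : StronglyMeasurable
      fun p : ℝ × Ω => lam p.1 p.2 * Real.exp (-(∫ u in t..p.1, lam u p.2)) :=
    hlam.mul (Real.continuous_exp.comp_stronglyMeasurable
      (stronglyMeasurable_intervalIntegral_prod hlam t).neg)
  refine (integrable_prod_iff' hsm.aestronglyMeasurable).2 ⟨.of_forall fun ω => ?_, ?_⟩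
  · exact (intervalIntegrable_iff_integrableOn_Ioc_of_le htT).1
      (intervalIntegrable_mul_exp_neg_integral (hlam_int ω))
  · refine Integrable.of_bound hsm.norm.integral_prod_left'.aestronglyMeasurable 1
      (.of_forall fun ω => ?_)
    have h : ∫ s in Set.Ioc t T, ‖lam s ω * Real.exp (-(∫ u in t..s, lam u ω))‖
        = 1 - Real.exp (-(∫ u in t..T, lam u ω)) := by
      rw [← integral_mul_exp_neg_integral htT (hlam0 · ω) (hlam_int ω),
        intervalIntegral.integral_of_le htT]
      exact integral_congr_ae (.of_forall fun s =>
        Real.norm_of_nonneg (mul_nonneg (hlam0 s ω) (Real.exp_pos _).le))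
    have hΛ : 0 ≤ ∫ u in t..T, lam u ω :=
      intervalIntegral.integral_nonneg htT fun u _ => hlam0 u ω
    rw [h, Real.norm_eq_abs, abs_of_nonneg (sub_nonneg.2 (Real.exp_le_one_iff.2 (by linarith)))]
    linarith [Real.exp_pos (-(∫ u in t..T, lam u ω))]

theorem MeasureTheory.condExp_integral_mul_of_ae_eq_condExp {Ω : Type*} {mΩ : MeasurableSpace Ω}
    {P : Measure Ω} [IsFiniteMeasure P] {ℱ : Filtration ℝ mΩ} {μ : Measure ℝ} [SFinite μ] {t : ℝ}
    {c W H : ℝ → Ω → ℝ} (hμ : ∀ᵐ s ∂μ, t ≤ s)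
    (hc : ∀ᵐ s ∂μ, c s =ᵐ[P] P[H s | ℱ s])
    (hW : ∀ᵐ s ∂μ, StronglyMeasurable[ℱ s] (W s))
    (hH : ∀ᵐ s ∂μ, Integrable (H s) P)
    (hcW : Integrable (Function.uncurry fun s ω => c s ω * W s ω) (μ.prod P))
    (hHW : Integrable (Function.uncurry fun s ω => H s ω * W s ω) (μ.prod P)) :
    P[fun ω => ∫ s, c s ω * W s ω ∂μ | ℱ t] =ᵐ[P] P[fun ω => ∫ s, H s ω * W s ω ∂μ | ℱ t] := by
  refine ae_eq_condExp_of_forall_setIntegral_eq (ℱ.le t) hHW.integral_prod_right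
    (fun _ _ _ => integrable_condExp.integrableOn) (fun A hA _ => ?_)
    stronglyMeasurable_condExp.aestronglyMeasurable
  have hint : Integrable (fun ω => ∫ s, c s ω * W s ω ∂μ) P := hcW.integral_prod_right
  rw [setIntegral_condExp (ℱ.le t) hint hA]
  have hμA : μ.prod (P.restrict A) = (μ.prod P).restrict (Set.univ ×ˢ A) := by
    rw [← Measure.prod_restrict, Measure.restrict_univ]
  rw [← integral_integral_swap (f := fun s ω => c s ω * W s ω) (by rw [hμA]; exact hcW.restrict),
    ← integral_integral_swap (f := fun s ω => H s ω * W s ω) (by rw [hμA]; exact hHW.restrict)]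
  refine integral_congr_ae ?_
  filter_upwards [hμ, hc, hW, hH, hHW.prod_right_ae] with s hts hcs hWs hHs hHWs
  replace hHWs : Integrable (fun ω => H s ω * W s ω) P := hHWs
  have hpull : P[fun ω => H s ω * W s ω | ℱ s] =ᵐ[P] P[H s | ℱ s] * W s :=
    condExp_mul_of_stronglyMeasurable_right hWs hHWs hHs
  rw [← setIntegral_condExp (ℱ.le s) hHWs (ℱ.mono hts A hA)]
  refine integral_congr_ae (ae_restrict_of_ae ?_)
  filter_upwards [hcs, hpull] with ω h1 h2
  rw [h1]
  exact h2.symm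

theorem MeasureTheory.condExp_integral_recovery {Ω : Type*} {mΩ : MeasurableSpace Ω}
    {P : Measure Ω} [IsFiniteMeasure P] {ℱ : Filtration ℝ mΩ} {r lam c : ℝ → Ω → ℝ} {ξ : Ω → ℝ}
    {t T C K : ℝ} (htT : t ≤ T)
    (hr : IsStronglyProgressive ℱ r) (hr' : StronglyMeasurable (Function.uncurry r))
    (hrC : ∀ s ω, |r s ω| ≤ C)
    (hlam : IsStronglyProgressive ℱ lam) (hlam' : StronglyMeasurable (Function.uncurry lam))
    (hlam0 : ∀ s ω, 0 ≤ lam s ω)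
    (hlam_int : ∀ ω, IntervalIntegrable (fun u => lam u ω) volume t T)
    (hξ : StronglyMeasurable ξ) (hξK : ∀ ω, |ξ ω| ≤ K)
    (hc_meas : Measurable fun p : ℝ × Ω => c p.1 p.2)
    (hc : ∀ s ∈ Set.Ioc t T, c s =ᵐ[P]
      P[fun ω => Real.exp (-(∫ u in s..T, r u ω)) * ξ ω | ℱ s]) :
    Integrable (fun ω => ∫ s in t..T, c s ω *
      (lam s ω * Real.exp (-(∫ u in t..s, (r u ω + lam u ω))))) P ∧
    P[fun ω => ∫ s in t..T, c s ω *
      (lam s ω * Real.exp (-(∫ u in t..s, (r u ω + lam u ω)))) | ℱ t] =ᵐ[P]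
    P[fun ω => Real.exp (-(∫ u in t..T, r u ω)) * ξ ω
      - Real.exp (-(∫ u in t..T, (r u ω + lam u ω))) * ξ ω | ℱ t] := by
  have hr_int : ∀ ω a b, IntervalIntegrable (fun u => r u ω) volume a b := fun ω a b =>
    intervalIntegrable_of_abs_le (hr'.comp_measurable measurable_prodMk_right) (hrC · ω)
  have hlam_int' : ∀ ω, ∀ s ∈ Set.Ioc t T, IntervalIntegrable (fun u => lam u ω) volume t s :=
    fun ω s hs => (hlam_int ω).mono_set (by
      rw [Set.uIcc_of_le hs.1.le, Set.uIcc_of_le htT]; exact Set.Icc_subset_Icc_right hs.2)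
  have hsplit : ∀ ω, ∀ s, IntervalIntegrable (fun u => lam u ω) volume t s →
      Real.exp (-(∫ u in t..s, (r u ω + lam u ω)))
        = Real.exp (-(∫ u in t..s, r u ω)) * Real.exp (-(∫ u in t..s, lam u ω)) :=
    fun ω s hs => by
      rw [intervalIntegral.integral_add (hr_int ω t s) hs, neg_add, Real.exp_add]
  set μ : Measure ℝ := volume.restrict (Set.Ioc t T)
  set W : ℝ → Ω → ℝ := fun s ω =>
    lam s ω * Real.exp (-(∫ u in t..s, (r u ω + lam u ω))) with hWdef
  set H : ℝ → Ω → ℝ := fun s ω => Real.exp (-(∫ u in s..T, r u ω)) * ξ ω with hHdef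
  set V : ℝ × Ω → ℝ := fun p => lam p.1 p.2 * Real.exp (-(∫ u in t..p.1, lam u p.2)) with hVdef
  have hmem : ∀ᵐ s ∂μ, s ∈ Set.Ioc t T := ae_restrict_mem measurableSet_Ioc
  have hmem_prod : ∀ᵐ p ∂(μ.prod P), p.1 ∈ Set.Ioc t T :=
    Measure.quasiMeasurePreserving_fst.ae hmem
  have hV : Integrable V (μ.prod P) :=
    integrable_prod_mul_exp_neg_integral htT hlam' hlam0 hlam_int
  have hW_meas : StronglyMeasurable (Function.uncurry W) :=
    hlam'.mul (Real.continuous_exp.comp_stronglyMeasurable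
      (stronglyMeasurable_intervalIntegral_prod (f := fun u ω => r u ω + lam u ω)
        (hr'.add hlam') t).neg)
  have hW : Integrable (Function.uncurry W) (μ.prod P) := by
    refine (hV.const_mul (Real.exp (C * (T - t)))).mono' hW_meas.aestronglyMeasurable ?_
    filter_upwards [hmem_prod] with ⟨s, ω⟩ hs
    have h := Real.exp_neg_intervalIntegral_le hs.1.le (sub_le_sub_right hs.2 t) (hrC · ω)
    simp only [Function.uncurry_apply_pair, hWdef, hVdef, hsplit ω s (hlam_int' ω s hs)]
    rw [Real.norm_of_nonneg (mul_nonneg (hlam0 s ω) (by positivity)), mul_left_comm]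
    exact mul_le_mul_of_nonneg_right h (mul_nonneg (hlam0 s ω) (by positivity))
  have hH_meas : ∀ s ∈ Set.Icc t T, StronglyMeasurable (H s) := fun s hs =>
    (Real.continuous_exp.comp_stronglyMeasurable
      ((hr.stronglyMeasurable_intervalIntegral hs.2).mono (ℱ.le T)).neg).mul hξ
  have hH_bound : ∀ s ∈ Set.Icc t T, ∀ ω, ‖H s ω‖ ≤ Real.exp (C * (T - t)) * K := by
    intro s hs ω
    simp only [hHdef, norm_mul, Real.norm_eq_abs, Real.abs_exp]
    exact mul_le_mul (Real.exp_neg_intervalIntegral_le hs.2 (sub_le_sub_left hs.1 T) (hrC · ω))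
      (hξK ω) (abs_nonneg _) (Real.exp_pos _).le
  have hc_bound : ∀ᵐ p ∂(μ.prod P), ‖c p.1 p.2‖ ≤ Real.exp (C * (T - t)) * K := by
    refine (Measure.ae_prod_iff_ae_ae (measurableSet_le hc_meas.norm measurable_const)).2 ?_
    filter_upwards [hmem] with s hs
    have hbd : ∀ᵐ ω ∂P, |(P[H s | ℱ s]) ω| ≤ Real.exp (C * (T - t)) * K :=
      ae_bdd_abs_condExp_of_ae_bdd_abs (.of_forall (hH_bound s (Set.Ioc_subset_Icc_self hs)))
    filter_upwards [hc s hs, hbd] with ω h1 h2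
    rwa [h1, Real.norm_eq_abs]
  have hcW : Integrable (Function.uncurry fun s ω => c s ω * W s ω) (μ.prod P) :=
    hW.bdd_mul hc_meas.aestronglyMeasurable hc_bound
  have hHW_eq : ∀ s ∈ Set.Ioc t T, ∀ ω, H s ω * W s ω = H t ω * V (s, ω) := by
    intro s hs ω
    simp only [hHdef, hWdef, hVdef, hsplit ω s (hlam_int' ω s hs),
      ← intervalIntegral.integral_add_adjacent_intervals (hr_int ω t s) (hr_int ω s T), neg_add,
      Real.exp_add]
    ring
  have ht_mem : t ∈ Set.Icc t T := ⟨le_rfl, htT⟩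
  have hHW : Integrable (Function.uncurry fun s ω => H s ω * W s ω) (μ.prod P) := by
    refine (hV.bdd_mul (f := fun p => H t p.2)
      ((hH_meas t ht_mem).comp_measurable measurable_snd).aestronglyMeasurable
      (.of_forall fun p => hH_bound t ht_mem p.2)).congr ?_
    filter_upwards [hmem_prod] with ⟨s, ω⟩ hs
    exact (hHW_eq s hs ω).symm
  simp only [intervalIntegral.integral_of_le htT]
  refine ⟨hcW.integral_prod_right, ?_⟩
  refine (condExp_integral_mul_of_ae_eq_condExp (W := W) (H := H) ?_ ?_ ?_ ?_ hcW hHW).trans ?_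
  · filter_upwards [hmem] with s hs using hs.1.le
  · filter_upwards [hmem] with s hs using hc s hs
  · filter_upwards [hmem] with s hs
    exact (hlam.stronglyAdapted s).mul (Real.continuous_exp.comp_stronglyMeasurable
      ((hr.add hlam).stronglyMeasurable_intervalIntegral hs.1.le).neg)
  · filter_upwards [hmem] with s hs
    exact .of_bound (hH_meas s (Set.Ioc_subset_Icc_self hs)).aestronglyMeasurable _
      (.of_forall (hH_bound s (Set.Ioc_subset_Icc_self hs)))
  · refine condExp_congr_ae (.of_forall fun ω => ?_)
    have h1 : ∫ s, H s ω * W s ω ∂μ = ∫ s, H t ω * V (s, ω) ∂μ := by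
      refine integral_congr_ae ?_
      filter_upwards [hmem] with s hs using hHW_eq s hs ω
    have h2 : ∫ s, V (s, ω) ∂μ = 1 - Real.exp (-(∫ u in t..T, lam u ω)) := by
      rw [← integral_mul_exp_neg_integral htT (hlam0 · ω) (hlam_int ω),
        intervalIntegral.integral_of_le htT]
    simp only [h1, integral_const_mul, h2]
    simp only [← intervalIntegral.integral_of_le htT, hsplit ω T (hlam_int ω), hHdef]
    ring

/-- Fractional recovery: with `Z_s = R·c(s,T)`, `0 ≤ R < 1`, where
`c(s,T) = E[B(s,T) ξ | ℱ_s]` is the default-free price, and assuming the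
representation `c^d(t,T) = 1_{τ>t} E[e^{-∫_t^T(r+λ)}ξ + ∫_t^T Z_s λ_s e^{-∫_t^s(r+λ)}ds | ℱ_t]`,
one has almost surely
`c^d(t,T) = 1_{τ>t} [ R·E(e^{-∫_t^T r}ξ | ℱ_t) + (1−R)·E(e^{-∫_t^T (r+λ)}ξ | ℱ_t) ]`. -/
theorem stmt8
    {Ω : Type*} {mΩ : MeasurableSpace Ω} (P : Measure Ω) [IsProbabilityMeasure P]
    (T : ℝ) (hT : 0 ≤ T)
    (ℱ : Filtration ℝ mΩ)
    (τ : Ω → ℝ) (hτmeas : Measurable τ) (hτpos : ∀ ω, 0 < τ ω)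
    -- bounded progressively measurable spot rate
    (r : ℝ → Ω → ℝ) (hr_prog : ProgMeasurable ℱ r)
    (hr_bdd : ∃ C, ∀ s ω, |r s ω| ≤ C)
    -- nonnegative progressively measurable intensity, integrable in time
    (lam : ℝ → Ω → ℝ) (hlam_nonneg : ∀ s ω, 0 ≤ lam s ω)
    (hlam_prog : ProgMeasurable ℱ lam)
    (hlam_int : ∀ ω, IntegrableOn (fun u => lam u ω) (Set.Icc 0 T) volume)
    -- bounded `ℱ_T`-measurable payoff
    (ξ : Ω → ℝ) (hξmeas : StronglyMeasurable[ℱ T] ξ) (hξbdd : ∃ C, ∀ ω, |ξ ω| ≤ C)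
    -- a jointly measurable version of the default-free price `c(s,T) = E[B(s,T) ξ | ℱ_s]`
    (c : ℝ → Ω → ℝ) (hc_meas : Measurable fun p : ℝ × Ω => c p.1 p.2)
    (hc : ∀ s, c s =ᵐ[P]
      P[fun ω => Real.exp (-(∫ u in s..T, r u ω)) * ξ ω | ℱ s])
    -- fractional recovery rate
    (R : ℝ) (hR0 : 0 ≤ R) (hR1 : R < 1)
    (t : ℝ) (ht : 0 ≤ t) (htT : t ≤ T)
    -- the defaultable price, assumed to satisfy the representation formula
    (cd : Ω → ℝ)
    (hrep : cd =ᵐ[P] fun ω => Set.indicator (τ ⁻¹' Set.Ioi t) (fun _ => (1 : ℝ)) ω *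
      (P[fun ω' => Real.exp (-(∫ s in t..T, (r s ω' + lam s ω'))) * ξ ω'
          + ∫ s in t..T, (R * c s ω') * lam s ω' *
              Real.exp (-(∫ u in t..s, (r u ω' + lam u ω'))) | ℱ t]) ω) :
    cd =ᵐ[P] fun ω => Set.indicator (τ ⁻¹' Set.Ioi t) (fun _ => (1 : ℝ)) ω *
      (R * (P[fun ω' => Real.exp (-(∫ u in t..T, r u ω')) * ξ ω' | ℱ t]) ω
        + (1 - R) *
          (P[fun ω' => Real.exp (-(∫ u in t..T, (r u ω' + lam u ω'))) * ξ ω' | ℱ t]) ω) := by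
  obtain ⟨C, hC⟩ := hr_bdd
  obtain ⟨K, hK⟩ := hξbdd
  have hξ : StronglyMeasurable ξ := hξmeas.mono (ℱ.le T)
  have hcongr : ∀ (f : ℝ → Ω → ℝ) (a b : ℝ), a ≤ T → b ≤ T → ∀ ω,
      ∫ u in a..b, f (min u T) ω = ∫ u in a..b, f u ω := fun f a b ha hb ω =>
    intervalIntegral.integral_congr fun u hu => by
      simp only [min_eq_left (hu.2.trans (max_le ha hb))]
  have hlam_ii : ∀ ω, IntervalIntegrable (fun u => lam u ω) volume t T := fun ω =>
    (intervalIntegrable_iff_integrableOn_Ioc_of_le htT).2 ((hlam_int ω).mono_set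
      (Set.Ioc_subset_Icc_self.trans (Set.Icc_subset_Icc_left ht)))
  have hlam_min : ∀ ω, IntervalIntegrable (fun u => lam (min u T) ω) volume t T := fun ω => by
    refine (hlam_ii ω).congr fun u hu => ?_
    rw [Set.uIoc_of_le htT] at hu
    simp only [min_eq_left hu.2]
  obtain ⟨hX, hXY⟩ := condExp_integral_recovery (P := P) htT (hr_prog.comp_min T)
    (hr_prog.stronglyMeasurable_uncurry_comp_min T) (fun s ω => hC (min s T) ω)
    (hlam_prog.comp_min T) (hlam_prog.stronglyMeasurable_uncurry_comp_min T)
    (fun s ω => hlam_nonneg (min s T) ω) hlam_min hξ hK hc_meas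
    (fun s hs => by simpa only [hcongr r s T hs.2 le_rfl] using hc s)
  set A : Ω → ℝ := fun ω => Real.exp (-(∫ u in t..T, (r u ω + lam u ω))) * ξ ω with hA
  set B : Ω → ℝ := fun ω => Real.exp (-(∫ u in t..T, r u ω)) * ξ ω with hB
  have hr_sm := hr_prog.stronglyMeasurable_intervalIntegral htT
  have hrl_sm : StronglyMeasurable[ℱ T] fun ω => ∫ u in t..T, (r u ω + lam u ω) :=
    (IsStronglyProgressive.add hr_prog hlam_prog).stronglyMeasurable_intervalIntegral htT
  have hB_int : Integrable B P := by
    refine .of_bound ((Real.continuous_exp.comp_stronglyMeasurable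
      (hr_sm.mono (ℱ.le T)).neg).mul hξ).aestronglyMeasurable (Real.exp (C * (T - t)) * K)
      (.of_forall fun ω => ?_)
    simp only [hB, norm_mul, Real.norm_eq_abs, Real.abs_exp]
    exact mul_le_mul (Real.exp_neg_intervalIntegral_le htT le_rfl (hC · ω)) (hK ω)
      (abs_nonneg _) (Real.exp_pos _).le
  have hA_le : ∀ ω, ‖A ω‖ ≤ ‖B ω‖ := fun ω => by
    have hr_min : IntervalIntegrable (fun u => r (min u T) ω) volume t T :=
      intervalIntegrable_of_abs_le ((hr_prog.stronglyMeasurable_uncurry_comp_min T).comp_measurable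
        measurable_prodMk_right) (fun s => hC (min s T) ω)
    simp only [hA, hB, norm_mul, Real.norm_eq_abs, Real.abs_exp]
    refine mul_le_mul_of_nonneg_right (Real.exp_le_exp.2 (neg_le_neg ?_)) (abs_nonneg _)
    rw [← hcongr r t T htT le_rfl, ← hcongr (fun u ω => r u ω + lam u ω) t T htT le_rfl]
    exact intervalIntegral.integral_mono_on htT hr_min (hr_min.add (hlam_min ω))
      fun u _ => le_add_of_nonneg_right (hlam_nonneg _ _)
  have hA_int : Integrable A P := hB_int.mono ((Real.continuous_exp.comp_stronglyMeasurable
    (hrl_sm.mono (ℱ.le T)).neg).mul hξ).aestronglyMeasurable (.of_forall hA_le)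
  have hX_eq : (fun ω => ∫ s in t..T, c s ω * (lam (min s T) ω *
        Real.exp (-(∫ u in t..s, (r (min u T) ω + lam (min u T) ω)))))
      = fun ω => ∫ s in t..T, c s ω * (lam s ω * Real.exp (-(∫ u in t..s, (r u ω + lam u ω)))) := by
    ext ω
    refine intervalIntegral.integral_congr fun s hs => ?_
    rw [Set.uIcc_of_le htT] at hs
    simp only [min_eq_left hs.2, hcongr (fun u ω => r u ω + lam u ω) t s htT hs.2]
  have hY_eq : (fun ω => Real.exp (-(∫ u in t..T, r (min u T) ω)) * ξ ω
      - Real.exp (-(∫ u in t..T, (r (min u T) ω + lam (min u T) ω))) * ξ ω) = B - A := by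
    ext ω
    simp only [hcongr r t T htT le_rfl, hcongr (fun u ω => r u ω + lam u ω) t T htT le_rfl, hA, hB,
      Pi.sub_apply]
  rw [hX_eq] at hX hXY
  rw [hY_eq] at hXY
  set X : Ω → ℝ := fun ω => ∫ s in t..T, c s ω *
    (lam s ω * Real.exp (-(∫ u in t..s, (r u ω + lam u ω)))) with hX_def
  have hint_eq : (fun ω => Real.exp (-(∫ s in t..T, (r s ω + lam s ω))) * ξ ω
      + ∫ s in t..T, (R * c s ω) * lam s ω * Real.exp (-(∫ u in t..s, (r u ω + lam u ω))))
      = A + R • X := by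
    ext ω
    simp only [hA, hX_def, Pi.add_apply, Pi.smul_apply, smul_eq_mul,
      ← intervalIntegral.integral_const_mul, mul_assoc]
  rw [hint_eq] at hrep
  filter_upwards [hrep, hXY, condExp_add hA_int (hX.smul R) (ℱ t), condExp_smul R X (ℱ t),
    condExp_sub hB_int hA_int (ℱ t)] with ω h1 h2 h3 h4 h5
  simp only [Pi.add_apply, Pi.smul_apply, Pi.sub_apply, smul_eq_mul] at h3 h4 h5
  rw [h1, h3, h4, h2, h5]
  ring
end

section
/- Let U : [0,T] × ℝ × ℝ → ℝ be three times continuously differentiable and satisfy ℒU = 0 on [0,T] × ℝ². Then the function V = ∂_x U satisfies on [0,T] × ℝ² the equation ℒV − (1−γ)ℒ^{1,x}V = 0, where ℒ^{1,x} = a(y)² e^{-2(1−γ)x} (∂_x − 1) + η c(s,y) a(y) e^{-(1−γ)x} ∂_y. -/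
/-- Partial derivative in the first (time) variable. -/
noncomputable def pds (f : ℝ → ℝ → ℝ → ℝ) (s x y : ℝ) : ℝ := deriv (fun u => f u x y) s

/-- Partial derivative in the second (log-price) variable. -/
noncomputable def pdx (f : ℝ → ℝ → ℝ → ℝ) (s x y : ℝ) : ℝ := deriv (fun u => f s u y) x

/-- Partial derivative in the third (volatility factor) variable. -/
noncomputable def pdy (f : ℝ → ℝ → ℝ → ℝ) (s x y : ℝ) : ℝ := deriv (fun u => f s x u) y

/-- The pricing operator
`ℒ = ∂_s + (a(y)² e^{-2(1−γ)x}/2)(∂²_{xx} − ∂_x) + (c(s,y)²/2)∂²_{yy}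
      + η a(y) c(s,y) e^{-(1−γ)x} ∂²_{xy} + b(s,y) ∂_y`. -/
noncomputable def Lop (γ η : ℝ) (a : ℝ → ℝ) (b c : ℝ → ℝ → ℝ)
    (f : ℝ → ℝ → ℝ → ℝ) (s x y : ℝ) : ℝ :=
  pds f s x y
    + (a y) ^ 2 * Real.exp (-2 * (1 - γ) * x) / 2 * (pdx (pdx f) s x y - pdx f s x y)
    + (c s y) ^ 2 / 2 * pdy (pdy f) s x y
    + η * a y * c s y * Real.exp (-(1 - γ) * x) * pdy (pdx f) s x y
    + b s y * pdy f s x y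

/-- The first-order correction operator
`ℒ^{1,x} = a(y)² e^{-2(1−γ)x} (∂_x − 1) + η c(s,y) a(y) e^{-(1−γ)x} ∂_y`. -/
noncomputable def L1x (γ η : ℝ) (a : ℝ → ℝ) (c : ℝ → ℝ → ℝ)
    (f : ℝ → ℝ → ℝ → ℝ) (s x y : ℝ) : ℝ :=
  (a y) ^ 2 * Real.exp (-2 * (1 - γ) * x) * (pdx f s x y - f s x y)
    + η * c s y * a y * Real.exp (-(1 - γ) * x) * pdy f s x y

/-- The function of one triple attached to a function of three variables. -/
def uncurryTriple (f : ℝ → ℝ → ℝ → ℝ) : ℝ × ℝ × ℝ → ℝ := fun p => f p.1 p.2.1 p.2.2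

theorem fderiv_apply_comm_of_contDiff_two {E : Type*} [NormedAddCommGroup E] [NormedSpace ℝ E]
    {F : E → ℝ} (hF : ContDiff ℝ 2 F) (v w p : E) :
    fderiv ℝ (fun q => fderiv ℝ F q v) p w = fderiv ℝ (fun q => fderiv ℝ F q w) p v := by
  have hd : DifferentiableAt ℝ (fderiv ℝ F) p :=
    (hF.fderiv_right (m := 1) (by norm_num)).differentiable (by norm_num) p
  have hsymm : IsSymmSndFDerivAt ℝ F p :=
    hF.contDiffAt.isSymmSndFDerivAt (by simp)
  rw [fderiv_clm_apply hd (differentiableAt_const v),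
    fderiv_clm_apply hd (differentiableAt_const w)]
  simpa using hsymm.eq w v

theorem contDiff_fderiv_apply_const {E : Type*} [NormedAddCommGroup E] [NormedSpace ℝ E]
    {F : E → ℝ} {m n : WithTop ℕ∞} (hF : ContDiff ℝ n F) (hmn : m + 1 ≤ n) (v : E) :
    ContDiff ℝ m (fun q => fderiv ℝ F q v) :=
  (hF.fderiv_right hmn).clm_apply contDiff_const

section PartialDerivatives

variable {f : ℝ → ℝ → ℝ → ℝ}

theorem hasDerivAt_fst (hf : Differentiable ℝ (uncurryTriple f)) (s x y : ℝ) :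
    HasDerivAt (fun u => f u x y) (fderiv ℝ (uncurryTriple f) (s, x, y) (1, 0, 0)) s :=
  HasFDerivAt.comp_hasDerivAt (l := uncurryTriple f) s (hf (s, x, y)).hasFDerivAt
    ((hasDerivAt_id s).prodMk ((hasDerivAt_const s x).prodMk (hasDerivAt_const s y)))

theorem hasDerivAt_snd (hf : Differentiable ℝ (uncurryTriple f)) (s x y : ℝ) :
    HasDerivAt (fun u => f s u y) (fderiv ℝ (uncurryTriple f) (s, x, y) (0, 1, 0)) x :=
  HasFDerivAt.comp_hasDerivAt (l := uncurryTriple f) x (hf (s, x, y)).hasFDerivAt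
    ((hasDerivAt_const x s).prodMk ((hasDerivAt_id x).prodMk (hasDerivAt_const x y)))

theorem hasDerivAt_thd (hf : Differentiable ℝ (uncurryTriple f)) (s x y : ℝ) :
    HasDerivAt (fun u => f s x u) (fderiv ℝ (uncurryTriple f) (s, x, y) (0, 0, 1)) y :=
  HasFDerivAt.comp_hasDerivAt (l := uncurryTriple f) y (hf (s, x, y)).hasFDerivAt
    ((hasDerivAt_const y s).prodMk ((hasDerivAt_const y x).prodMk (hasDerivAt_id y)))

theorem uncurryTriple_pds (hf : Differentiable ℝ (uncurryTriple f)) :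
    uncurryTriple (pds f) = fun p => fderiv ℝ (uncurryTriple f) p (1, 0, 0) :=
  funext fun p => (hasDerivAt_fst hf p.1 p.2.1 p.2.2).deriv

theorem uncurryTriple_pdx (hf : Differentiable ℝ (uncurryTriple f)) :
    uncurryTriple (pdx f) = fun p => fderiv ℝ (uncurryTriple f) p (0, 1, 0) :=
  funext fun p => (hasDerivAt_snd hf p.1 p.2.1 p.2.2).deriv

theorem uncurryTriple_pdy (hf : Differentiable ℝ (uncurryTriple f)) :
    uncurryTriple (pdy f) = fun p => fderiv ℝ (uncurryTriple f) p (0, 0, 1) :=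
  funext fun p => (hasDerivAt_thd hf p.1 p.2.1 p.2.2).deriv

theorem hasDerivAt_pdx (hf : Differentiable ℝ (uncurryTriple f)) (s x y : ℝ) :
    HasDerivAt (fun u => f s u y) (pdx f s x y) x :=
  (hasDerivAt_snd hf s x y).differentiableAt.hasDerivAt

variable {m n : WithTop ℕ∞}

theorem differentiable_of_add_one_le (hf : ContDiff ℝ n (uncurryTriple f)) (hmn : m + 1 ≤ n) :
    Differentiable ℝ (uncurryTriple f) :=
  (hf.of_le (le_trans le_add_self hmn)).differentiable one_ne_zero

theorem contDiff_pds (hf : ContDiff ℝ n (uncurryTriple f)) (hmn : m + 1 ≤ n) :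
    ContDiff ℝ m (uncurryTriple (pds f)) := by
  rw [uncurryTriple_pds (differentiable_of_add_one_le hf hmn)]
  exact contDiff_fderiv_apply_const hf hmn _

theorem contDiff_pdx (hf : ContDiff ℝ n (uncurryTriple f)) (hmn : m + 1 ≤ n) :
    ContDiff ℝ m (uncurryTriple (pdx f)) := by
  rw [uncurryTriple_pdx (differentiable_of_add_one_le hf hmn)]
  exact contDiff_fderiv_apply_const hf hmn _

theorem contDiff_pdy (hf : ContDiff ℝ n (uncurryTriple f)) (hmn : m + 1 ≤ n) :
    ContDiff ℝ m (uncurryTriple (pdy f)) := by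
  rw [uncurryTriple_pdy (differentiable_of_add_one_le hf hmn)]
  exact contDiff_fderiv_apply_const hf hmn _

theorem pdx_pds_comm (hf : ContDiff ℝ 2 (uncurryTriple f)) : pdx (pds f) = pds (pdx f) := by
  have hd := hf.differentiable two_ne_zero
  have hds := (contDiff_pds (m := 1) hf (by norm_num)).differentiable one_ne_zero
  have hdx := (contDiff_pdx (m := 1) hf (by norm_num)).differentiable one_ne_zero
  funext s x y
  refine (hasDerivAt_snd hds s x y).deriv.trans (Eq.trans ?_ (hasDerivAt_fst hdx s x y).deriv.symm)
  rw [uncurryTriple_pds hd, uncurryTriple_pdx hd]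
  exact fderiv_apply_comm_of_contDiff_two hf _ _ _

theorem pdx_pdy_comm (hf : ContDiff ℝ 2 (uncurryTriple f)) : pdx (pdy f) = pdy (pdx f) := by
  have hd := hf.differentiable two_ne_zero
  have hdy := (contDiff_pdy (m := 1) hf (by norm_num)).differentiable one_ne_zero
  have hdx := (contDiff_pdx (m := 1) hf (by norm_num)).differentiable one_ne_zero
  funext s x y
  refine (hasDerivAt_snd hdy s x y).deriv.trans (Eq.trans ?_ (hasDerivAt_thd hdx s x y).deriv.symm)
  rw [uncurryTriple_pdy hd, uncurryTriple_pdx hd]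
  exact fderiv_apply_comm_of_contDiff_two hf _ _ _

end PartialDerivatives

/-- Differentiating `ℒU` in `x`: the commutator of `∂_x` and `ℒ` is `-(1−γ)ℒ^{1,x}∂_x`. -/
theorem hasDerivAt_Lop (γ η : ℝ) (a : ℝ → ℝ) (b c : ℝ → ℝ → ℝ) {U : ℝ → ℝ → ℝ → ℝ}
    (hU : ContDiff ℝ 3 (uncurryTriple U)) (s x y : ℝ) :
    HasDerivAt (fun u => Lop γ η a b c U s u y)
      (Lop γ η a b c (pdx U) s x y - (1 - γ) * L1x γ η a c (pdx U) s x y) x := by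
  have hU2 : ContDiff ℝ 2 (uncurryTriple U) := hU.of_le (by norm_num)
  have hx : ContDiff ℝ 2 (uncurryTriple (pdx U)) := contDiff_pdx hU (by norm_num)
  have hy : ContDiff ℝ 2 (uncurryTriple (pdy U)) := contDiff_pdy hU (by norm_num)
  have hs : ContDiff ℝ 2 (uncurryTriple (pds U)) := contDiff_pds hU (by norm_num)
  have hxx : ContDiff ℝ 1 (uncurryTriple (pdx (pdx U))) := contDiff_pdx hx (by norm_num)
  have hyx : ContDiff ℝ 1 (uncurryTriple (pdy (pdx U))) := contDiff_pdy hx (by norm_num)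
  have hyy : ContDiff ℝ 1 (uncurryTriple (pdy (pdy U))) := contDiff_pdy hy (by norm_num)
  have ds := hasDerivAt_pdx (hs.differentiable two_ne_zero) s x y
  have dx := hasDerivAt_pdx (hx.differentiable two_ne_zero) s x y
  have dy := hasDerivAt_pdx (hy.differentiable two_ne_zero) s x y
  have dxx := hasDerivAt_pdx (hxx.differentiable one_ne_zero) s x y
  have dyx := hasDerivAt_pdx (hyx.differentiable one_ne_zero) s x y
  have dyy := hasDerivAt_pdx (hyy.differentiable one_ne_zero) s x y
  rw [pdx_pds_comm hU2] at ds
  rw [pdx_pdy_comm hU2] at dy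
  rw [pdx_pdy_comm hx] at dyx
  rw [pdx_pdy_comm hy, pdx_pdy_comm hU2] at dyy
  have dexp : ∀ k : ℝ, HasDerivAt (fun u => Real.exp (k * u)) (Real.exp (k * x) * k) x :=
    fun k => by simpa using ((hasDerivAt_id x).const_mul k).exp
  have key := (((ds.add ((((dexp (-2 * (1 - γ))).const_mul (a y ^ 2)).div_const 2).mul
    (dxx.sub dx))).add (dyy.const_mul (c s y ^ 2 / 2))).add
    (((dexp (-(1 - γ))).const_mul (η * a y * c s y)).mul dyx)).add (dy.const_mul (b s y))
  refine key.congr_deriv ?_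
  simp only [Lop, L1x, Pi.sub_apply]
  ring

/-- If `U` is `C³` and `ℒU = 0` on `[0,T] × ℝ²`, then `V = ∂_x U` satisfies
`ℒV − (1−γ)ℒ^{1,x}V = 0` there. -/
theorem stmt11 (T γ η : ℝ) (hγ0 : 0 < γ) (hγ1 : γ ≤ 1)
    (a : ℝ → ℝ) (ha : ContDiff ℝ 1 a)
    (b c : ℝ → ℝ → ℝ)
    (hb : ∀ s, ContDiff ℝ 1 (b s)) (hc : ∀ s, ContDiff ℝ 1 (c s))
    (U : ℝ → ℝ → ℝ → ℝ)
    (hU : ContDiff ℝ 3 (fun p : ℝ × ℝ × ℝ => U p.1 p.2.1 p.2.2))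
    (hLU : ∀ s ∈ Set.Icc (0 : ℝ) T, ∀ x y : ℝ, Lop γ η a b c U s x y = 0) :
    ∀ s ∈ Set.Icc (0 : ℝ) T, ∀ x y : ℝ,
      Lop γ η a b c (pdx U) s x y - (1 - γ) * L1x γ η a c (pdx U) s x y = 0 := by
  intro s hs x y
  have hzero : (fun u => Lop γ η a b c U s u y) = fun _ => 0 := funext fun u => hLU s hs u y
  have h := hasDerivAt_Lop γ η a b c hU s x y
  rw [hzero] at h
  exact h.unique (hasDerivAt_const x 0)
end

section
/- Let U : [0,T] × ℝ × ℝ → ℝ be three times continuously differentiable and satisfy ℒU = 0 on [0,T] × ℝ². Then the function W = ∂_y U satisfies on [0,T] × ℝ² the equation ℒW + ℒ^{1,y}W + a(y)a'(y) e^{-2(1−γ)x} (∂_x − 1)(∂_x U) = 0, where ℒ^{1,y} = c(s,y) ∂_y c(s,y) · ∂_y + η [a'(y) c(s,y) + a(y) ∂_y c(s,y)] e^{-(1−γ)x} ∂_x + ∂_y b(s,y). -/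
/-- The first-order correction operator
`ℒ^{1,y} = c(s,y) ∂_y c(s,y) · ∂_y + η [a'(y) c(s,y) + a(y) ∂_y c(s,y)] e^{-(1−γ)x} ∂_x
            + ∂_y b(s,y)`. -/
noncomputable def L1y (γ η : ℝ) (a : ℝ → ℝ) (b c : ℝ → ℝ → ℝ)
    (f : ℝ → ℝ → ℝ → ℝ) (s x y : ℝ) : ℝ :=
  c s y * deriv (c s) y * pdy f s x y
    + η * (deriv a y * c s y + a y * deriv (c s) y) * Real.exp (-(1 - γ) * x) * pdx f s x y
    + deriv (b s) y * f s x y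

section PartialDerivatives

variable {f : ℝ → ℝ → ℝ → ℝ}

lemma hasDerivAt_fst_of_differentiable
    (hf : Differentiable ℝ (fun p : ℝ × ℝ × ℝ => f p.1 p.2.1 p.2.2)) (s x y : ℝ) :
    HasDerivAt (fun u => f u x y)
      (fderiv ℝ (fun p : ℝ × ℝ × ℝ => f p.1 p.2.1 p.2.2) (s, x, y) (1, 0, 0)) s :=
  HasFDerivAt.comp_hasDerivAt (f := fun u => (u, x, y)) s (hf (s, x, y)).hasFDerivAt
    ((hasDerivAt_id s).prodMk ((hasDerivAt_const s x).prodMk (hasDerivAt_const s y)))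

lemma hasDerivAt_snd_of_differentiable
    (hf : Differentiable ℝ (fun p : ℝ × ℝ × ℝ => f p.1 p.2.1 p.2.2)) (s x y : ℝ) :
    HasDerivAt (fun u => f s u y)
      (fderiv ℝ (fun p : ℝ × ℝ × ℝ => f p.1 p.2.1 p.2.2) (s, x, y) (0, 1, 0)) x :=
  HasFDerivAt.comp_hasDerivAt (f := fun u => (s, u, y)) x (hf (s, x, y)).hasFDerivAt
    ((hasDerivAt_const x s).prodMk ((hasDerivAt_id x).prodMk (hasDerivAt_const x y)))

lemma hasDerivAt_thd_of_differentiable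
    (hf : Differentiable ℝ (fun p : ℝ × ℝ × ℝ => f p.1 p.2.1 p.2.2)) (s x y : ℝ) :
    HasDerivAt (fun u => f s x u)
      (fderiv ℝ (fun p : ℝ × ℝ × ℝ => f p.1 p.2.1 p.2.2) (s, x, y) (0, 0, 1)) y :=
  HasFDerivAt.comp_hasDerivAt (f := fun u => (s, x, u)) y (hf (s, x, y)).hasFDerivAt
    ((hasDerivAt_const y s).prodMk ((hasDerivAt_const y x).prodMk (hasDerivAt_id y)))

lemma uncurry_pds (hf : Differentiable ℝ (fun p : ℝ × ℝ × ℝ => f p.1 p.2.1 p.2.2)) :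
    (fun p : ℝ × ℝ × ℝ => pds f p.1 p.2.1 p.2.2) =
      fun p => fderiv ℝ (fun p : ℝ × ℝ × ℝ => f p.1 p.2.1 p.2.2) p (1, 0, 0) :=
  funext fun p => (hasDerivAt_fst_of_differentiable hf p.1 p.2.1 p.2.2).deriv

lemma uncurry_pdx (hf : Differentiable ℝ (fun p : ℝ × ℝ × ℝ => f p.1 p.2.1 p.2.2)) :
    (fun p : ℝ × ℝ × ℝ => pdx f p.1 p.2.1 p.2.2) =
      fun p => fderiv ℝ (fun p : ℝ × ℝ × ℝ => f p.1 p.2.1 p.2.2) p (0, 1, 0) :=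
  funext fun p => (hasDerivAt_snd_of_differentiable hf p.1 p.2.1 p.2.2).deriv

lemma uncurry_pdy (hf : Differentiable ℝ (fun p : ℝ × ℝ × ℝ => f p.1 p.2.1 p.2.2)) :
    (fun p : ℝ × ℝ × ℝ => pdy f p.1 p.2.1 p.2.2) =
      fun p => fderiv ℝ (fun p : ℝ × ℝ × ℝ => f p.1 p.2.1 p.2.2) p (0, 0, 1) :=
  funext fun p => (hasDerivAt_thd_of_differentiable hf p.1 p.2.1 p.2.2).deriv

lemma hasDerivAt_pdy
    (hf : Differentiable ℝ (fun p : ℝ × ℝ × ℝ => f p.1 p.2.1 p.2.2)) (s x y : ℝ) :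
    HasDerivAt (f s x) (pdy f s x y) y :=
  (hasDerivAt_thd_of_differentiable hf s x y).differentiableAt.hasDerivAt

lemma contDiff_pds_s12 {n : ℕ}
    (hf : ContDiff ℝ (n + 1) (fun p : ℝ × ℝ × ℝ => f p.1 p.2.1 p.2.2)) :
    ContDiff ℝ n (fun p : ℝ × ℝ × ℝ => pds f p.1 p.2.1 p.2.2) := by
  rw [uncurry_pds (hf.differentiable (by simp))]
  exact (hf.fderiv_right le_rfl).clm_apply contDiff_const

lemma contDiff_pdx_s12 {n : ℕ}
    (hf : ContDiff ℝ (n + 1) (fun p : ℝ × ℝ × ℝ => f p.1 p.2.1 p.2.2)) :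
    ContDiff ℝ n (fun p : ℝ × ℝ × ℝ => pdx f p.1 p.2.1 p.2.2) := by
  rw [uncurry_pdx (hf.differentiable (by simp))]
  exact (hf.fderiv_right le_rfl).clm_apply contDiff_const

lemma contDiff_pdy_s12 {n : ℕ}
    (hf : ContDiff ℝ (n + 1) (fun p : ℝ × ℝ × ℝ => f p.1 p.2.1 p.2.2)) :
    ContDiff ℝ n (fun p : ℝ × ℝ × ℝ => pdy f p.1 p.2.1 p.2.2) := by
  rw [uncurry_pdy (hf.differentiable (by simp))]
  exact (hf.fderiv_right le_rfl).clm_apply contDiff_const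

/-- Directional derivatives of a `C²` function commute. -/
lemma fderiv_fderiv_apply_comm {E : Type*} [NormedAddCommGroup E] [NormedSpace ℝ E]
    {F : E → ℝ} (hF : ContDiff ℝ 2 F) (p v w : E) :
    fderiv ℝ (fun q => fderiv ℝ F q v) p w = fderiv ℝ (fun q => fderiv ℝ F q w) p v := by
  have hd : DifferentiableAt ℝ (fderiv ℝ F) p :=
    (hF.fderiv_right (m := 1) (by norm_num)).differentiable (by simp) p
  have h (v w : E) : fderiv ℝ (fun q => fderiv ℝ F q v) p w = fderiv ℝ (fderiv ℝ F) p w v := by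
    rw [fderiv_clm_apply hd (differentiableAt_const v)]
    simp
  rw [h, h]
  exact hF.contDiffAt.isSymmSndFDerivAt (by simp) w v

lemma pdy_pds_comm (hf : ContDiff ℝ 2 (fun p : ℝ × ℝ × ℝ => f p.1 p.2.1 p.2.2)) :
    pdy (pds f) = pds (pdy f) := by
  have hd := hf.differentiable (by simp)
  have hs := (contDiff_pds_s12 (n := 1) (by exact_mod_cast hf)).differentiable (by simp)
  have hy := (contDiff_pdy_s12 (n := 1) (by exact_mod_cast hf)).differentiable (by simp)
  ext s x y
  refine (congrFun (uncurry_pdy hs) (s, x, y)).trans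
    (.trans ?_ (congrFun (uncurry_pds hy) (s, x, y)).symm)
  rw [uncurry_pds hd, uncurry_pdy hd]
  exact fderiv_fderiv_apply_comm hf _ _ _

lemma pdy_pdx_comm (hf : ContDiff ℝ 2 (fun p : ℝ × ℝ × ℝ => f p.1 p.2.1 p.2.2)) :
    pdy (pdx f) = pdx (pdy f) := by
  have hd := hf.differentiable (by simp)
  have hx := (contDiff_pdx_s12 (n := 1) (by exact_mod_cast hf)).differentiable (by simp)
  have hy := (contDiff_pdy_s12 (n := 1) (by exact_mod_cast hf)).differentiable (by simp)
  ext s x y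
  refine (congrFun (uncurry_pdy hx) (s, x, y)).trans
    (.trans ?_ (congrFun (uncurry_pdx hy) (s, x, y)).symm)
  rw [uncurry_pdx hd, uncurry_pdy hd]
  exact fderiv_fderiv_apply_comm hf _ _ _

end PartialDerivatives

/-- If `U` is `C³` and `ℒU = 0` on `[0,T] × ℝ²`, then `W = ∂_y U` satisfies
`ℒW + ℒ^{1,y}W + a(y) a'(y) e^{-2(1−γ)x} (∂_x − 1)(∂_x U) = 0` there. -/
theorem stmt12 (T γ η : ℝ) (hγ0 : 0 < γ) (hγ1 : γ ≤ 1)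
    (a : ℝ → ℝ) (ha : ContDiff ℝ 1 a)
    (b c : ℝ → ℝ → ℝ)
    (hb : ∀ s, ContDiff ℝ 1 (b s)) (hc : ∀ s, ContDiff ℝ 1 (c s))
    (U : ℝ → ℝ → ℝ → ℝ)
    (hU : ContDiff ℝ 3 (fun p : ℝ × ℝ × ℝ => U p.1 p.2.1 p.2.2))
    (hLU : ∀ s ∈ Set.Icc (0 : ℝ) T, ∀ x y : ℝ, Lop γ η a b c U s x y = 0) :
    ∀ s ∈ Set.Icc (0 : ℝ) T, ∀ x y : ℝ,
      Lop γ η a b c (pdy U) s x y + L1y γ η a b c (pdy U) s x y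
        + a y * deriv a y * Real.exp (-2 * (1 - γ) * x) *
            (pdx (pdx U) s x y - pdx U s x y) = 0 := by
  intro s hs x y
  have hU2 : ContDiff ℝ 2 (fun p : ℝ × ℝ × ℝ => U p.1 p.2.1 p.2.2) := hU.of_le (by norm_num)
  have hUs := contDiff_pds_s12 (n := 2) (f := U) (by norm_num; exact hU)
  have hUx := contDiff_pdx_s12 (n := 2) (f := U) (by norm_num; exact hU)
  have hUy := contDiff_pdy_s12 (n := 2) (f := U) (by norm_num; exact hU)
  have hUxx := contDiff_pdx_s12 (n := 1) (f := pdx U) (by norm_num; exact hUx)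
  have hUyx := contDiff_pdy_s12 (n := 1) (f := pdx U) (by norm_num; exact hUx)
  have hUyy := contDiff_pdy_s12 (n := 1) (f := pdy U) (by norm_num; exact hUy)
  have das := hasDerivAt_pdy (hUs.differentiable (by simp)) s x y
  have dax := hasDerivAt_pdy (hUx.differentiable (by simp)) s x y
  have day := hasDerivAt_pdy (hUy.differentiable (by simp)) s x y
  have daxx := hasDerivAt_pdy (hUxx.differentiable (by simp)) s x y
  have dayx := hasDerivAt_pdy (hUyx.differentiable (by simp)) s x y
  have dayy := hasDerivAt_pdy (hUyy.differentiable (by simp)) s x y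
  have da := (ha.differentiable (by simp) y).hasDerivAt
  have db := ((hb s).differentiable (by simp) y).hasDerivAt
  have dc := ((hc s).differentiable (by simp) y).hasDerivAt
  have hL := ((((das.add ((((da.pow 2).mul_const (Real.exp (-2 * (1 - γ) * x))).div_const 2).mul
    (daxx.sub dax))).add (((dc.pow 2).div_const 2).mul dayy)).add
    ((((da.const_mul η).mul dc).mul_const (Real.exp (-(1 - γ) * x))).mul dayx)).add
    (db.mul day))
  have h0 := hL.unique ((hasDerivAt_const y (0 : ℝ)).congr_of_eventuallyEq
    (.of_forall fun u => hLU s hs x u))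
  rw [pdy_pds_comm hU2, pdy_pdx_comm (by exact_mod_cast hUx), pdy_pdx_comm hU2] at h0
  simp only [Lop, L1y]
  simp only [Pi.pow_apply, Pi.mul_apply, Pi.sub_apply] at h0
  linear_combination h0
end
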